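/- arXiv:2601.12620 — 2 statements merged into one kernel-verified Lean document; each statement's English description precedes it below -/
import Mathlib

section
/- For every integer r ≥ 2, the set of growth rates of finitely generated subgroups of the free group F_r is dense in the interval [1, 2r−1]. Precisely: for every real α with 1 ≤ α ≤ 2r−1 and every ε > 0, there exist a finitely generated subgroup H of F_r and a real number L such that the sequence n ↦ (γ_H(n))^{1/n} tends to L as n → ∞ and |L − α| < ε. -/
open Filter Topology

/-- The growth function of a subgroup `H` of the free group `F_r`:
`γ_H(n)` counts the elements of `H` whose word length (length of the reduced
word with respect to the free generating set) is at most `n`. -/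
noncomputable def subgroupGrowth {r : ℕ} (H : Subgroup (FreeGroup (Fin r))) (n : ℕ) : ℕ :=
  Nat.card {h : FreeGroup (Fin r) // h ∈ H ∧ (FreeGroup.toWord h).length ≤ n}

/-! ### Existence of the growth rate -/

/-- A sequence which is submultiplicative up to a bounded shift has a limiting growth rate. -/
theorem exists_tendsto_root_of_shifted_submultiplicative {a : ℕ → ℝ} (one_le : ∀ n, 1 ≤ a n)
    (D : ℕ) (hD : ∀ m n, a (m + n) ≤ a (m + D) * a (n + D)) :
    ∃ L : ℝ, 1 ≤ L ∧ Tendsto (fun n : ℕ => a n ^ (1 / (n : ℝ))) atTop (𝓝 L) := by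
  have pos : ∀ n, 0 < a n := fun n => one_pos.trans_le (one_le n)
  set u : ℕ → ℝ := fun n => Real.log (a (n + 2 * D)) with hu
  have hsub : Subadditive u := by
    intro m n
    simp only [hu]
    rw [← Real.log_mul (pos _).ne' (pos _).ne']
    refine Real.log_le_log (pos _) ?_
    have := hD (m + D) (n + D)
    convert this using 2 <;> ring_nf
  have hbdd : BddBelow (Set.range fun n => u n / n) := by
    refine ⟨0, ?_⟩
    rintro _ ⟨n, rfl⟩
    exact div_nonneg (Real.log_nonneg (one_le _)) (Nat.cast_nonneg _)
  have hlim := hsub.tendsto_lim hbdd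
  have hlog : Tendsto (fun n : ℕ => Real.log (a n) / n) atTop (𝓝 hsub.lim) := by
    rw [← tendsto_add_atTop_iff_nat (2 * D)]
    have h1 := hlim.mul (tendsto_natCast_div_add_atTop ((2 * D : ℕ) : ℝ))
    rw [mul_one] at h1
    refine h1.congr' ?_
    filter_upwards [eventually_gt_atTop 0] with n hn
    have : (0 : ℝ) < n := by exact_mod_cast hn
    simp only [hu]
    push_cast
    field_simp
  refine ⟨Real.exp hsub.lim, Real.one_le_exp ?_, ?_⟩
  · exact ge_of_tendsto' hlog fun n =>
      div_nonneg (Real.log_nonneg (one_le _)) (Nat.cast_nonneg _)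
  · refine ((Real.continuous_exp.tendsto _).comp hlog).congr fun n => ?_
    simp only [Function.comp]
    rw [Real.rpow_def_of_pos (pos n), mul_one_div]

namespace FreeGroup

theorem finite_norm_le {α : Type*} [Finite α] [DecidableEq α] (n : ℕ) :
    {g : FreeGroup α | g.norm ≤ n}.Finite :=
  (List.finite_length_le (α × Bool) n).preimage toWord_injective.injOn

theorem Red.exists_prefix {α : Type*} {L₁ L₂ : List (α × Bool)} (h : Red L₁ L₂) :
    ∀ p, p <+: L₂ → ∃ p', p' <+: L₁ ∧ mk p' = mk p := by
  induction h using Relation.ReflTransGen.head_induction_on with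
  | refl => exact fun p hp => ⟨p, hp, rfl⟩
  | head hstep _ ih =>
    intro p hp
    obtain ⟨p', hp', hmk⟩ := ih p hp
    rw [← hmk]
    obtain @⟨A, B, x, b⟩ := hstep
    rcases List.prefix_or_prefix_of_prefix hp' (List.prefix_append _ _) with h | ⟨t, rfl⟩
    · exact ⟨p', h.trans (List.prefix_append _ _), rfl⟩
    · refine ⟨A ++ (x, b) :: (x, !b) :: t, ?_, Quot.sound Red.Step.not⟩
      simpa using (List.prefix_append_right_inj _).1 hp'

/-- Finitely generated subgroups are quasiconvex: every vertex on the geodesic from `1` to an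
element of the subgroup is at bounded distance from the subgroup. -/
theorem exists_mk_prefix_mul_mem {α : Type*} [DecidableEq α] {H : Subgroup (FreeGroup α)}
    (hH : H.FG) :
    ∃ D : ℕ, ∀ h ∈ H, ∀ p, p <+: toWord h → ∃ q : FreeGroup α, q.norm ≤ D ∧ mk p * q ∈ H := by
  obtain ⟨S, rfl⟩ := hH
  refine ⟨S.sup norm, fun h hh => ?_⟩
  have key : ∀ x s : FreeGroup α, x ∈ Subgroup.closure (S : Set (FreeGroup α)) →
      s ∈ Subgroup.closure (S : Set (FreeGroup α)) → s.norm ≤ S.sup norm →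
      (∀ p, p <+: toWord x → ∃ q : FreeGroup α, q.norm ≤ S.sup norm ∧
        mk p * q ∈ Subgroup.closure (S : Set (FreeGroup α))) →
      ∀ p, p <+: toWord (x * s) → ∃ q : FreeGroup α, q.norm ≤ S.sup norm ∧
        mk p * q ∈ Subgroup.closure (S : Set (FreeGroup α)) := by
    intro x s hx hs hsn ih p hp
    rw [toWord_mul] at hp
    obtain ⟨p', hp', hmk⟩ := Red.exists_prefix reduce.red p hp
    rw [← hmk]
    rcases List.prefix_or_prefix_of_prefix hp' (List.prefix_append _ _) with h | ⟨p'', rfl⟩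
    · exact ih p' h
    · obtain ⟨t, ht⟩ := (List.prefix_append_right_inj _).1 hp'
      refine ⟨mk t, ?_, ?_⟩
      · refine norm_mk_le.trans (le_trans ?_ hsn)
        rw [norm, ← ht]
        simp
      · rw [mul_mk, List.append_assoc, ht, ← mul_mk, mk_toWord, mk_toWord]
        exact mul_mem hx hs
  induction hh using Subgroup.closure_induction_right with
  | one =>
    intro p hp
    rw [toWord_one, List.prefix_nil] at hp
    subst hp
    exact ⟨1, by simp, by rw [← one_eq_mk, one_mul]; exact one_mem _⟩
  | mul_right x hx y hy ih =>
    exact key x y hx (Subgroup.subset_closure hy) (Finset.le_sup (f := norm) hy) ih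
  | mul_inv_cancel x hx y hy ih =>
    refine key x y⁻¹ hx (inv_mem (Subgroup.subset_closure hy)) ?_ ih
    rw [norm_inv_eq]
    exact Finset.le_sup (f := norm) hy

end FreeGroup

open FreeGroup

theorem finite_subgroup_ball {r : ℕ} (H : Subgroup (FreeGroup (Fin r))) (n : ℕ) :
    Finite {h : FreeGroup (Fin r) // h ∈ H ∧ (toWord h).length ≤ n} :=
  ((finite_norm_le n).subset fun _ h => h.2 :
    {h : FreeGroup (Fin r) | h ∈ H ∧ (toWord h).length ≤ n}.Finite)

theorem one_le_subgroupGrowth {r : ℕ} (H : Subgroup (FreeGroup (Fin r))) (n : ℕ) :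
    1 ≤ subgroupGrowth H n := by
  have := finite_subgroup_ball H n
  have : Nonempty {h : FreeGroup (Fin r) // h ∈ H ∧ (toWord h).length ≤ n} :=
    ⟨1, one_mem H, by simp⟩
  exact Nat.card_pos

theorem exists_subgroupGrowth_add_le {r : ℕ} {H : Subgroup (FreeGroup (Fin r))} (hH : H.FG) :
    ∃ D, ∀ m n, subgroupGrowth H (m + n) ≤ subgroupGrowth H (m + D) * subgroupGrowth H (n + D) := by
  obtain ⟨D, hD⟩ := exists_mk_prefix_mul_mem hH
  refine ⟨D, fun m n => ?_⟩
  have := finite_subgroup_ball H (m + D)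
  have := finite_subgroup_ball H (n + D)
  unfold subgroupGrowth
  rw [← Nat.card_prod]
  choose q hqD hqH using fun h : {h : FreeGroup (Fin r) // h ∈ H ∧ (toWord h).length ≤ m + n} =>
    hD h.1 h.2.1 ((toWord h.1).take m) (List.take_prefix _ _)
  have hsplit : ∀ h : FreeGroup (Fin r), mk ((toWord h).take m) * mk ((toWord h).drop m) = h :=
    fun h => by rw [mul_mk, List.take_append_drop, mk_toWord]
  refine Nat.card_le_card_of_injective (fun h => (⟨mk ((toWord h.1).take m) * q h, hqH h, ?_⟩,
    ⟨(mk ((toWord h.1).take m) * q h)⁻¹ * h.1, mul_mem (inv_mem (hqH h)) h.2.1, ?_⟩)) ?_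
  · refine (FreeGroup.norm_mul_le _ _).trans <|
      add_le_add (norm_mk_le.trans (List.length_take_le _ _)) (hqD h)
  · have : (mk ((toWord h.1).take m) * q h)⁻¹ * h.1 = (q h)⁻¹ * mk ((toWord h.1).drop m) := by
      nth_rewrite 2 [← hsplit h.1]
      group
    rw [this, add_comm n]
    refine (FreeGroup.norm_mul_le _ _).trans <|
      add_le_add (norm_inv_eq.trans_le (hqD h)) (norm_mk_le.trans ?_)
    have := h.2.2
    simp only [List.length_drop]
    omega
  · intro h h' heq
    simp only [Prod.mk.injEq, Subtype.mk.injEq] at heq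
    refine Subtype.ext ?_
    have := congrArg₂ (· * ·) heq.1 heq.2
    simpa only [mul_inv_cancel_left] using this

theorem exists_growth_rate {r : ℕ} {H : Subgroup (FreeGroup (Fin r))} (hH : H.FG) :
    ∃ L : ℝ, 1 ≤ L ∧
      Tendsto (fun n : ℕ => (subgroupGrowth H n : ℝ) ^ (1 / (n : ℝ))) atTop (𝓝 L) := by
  obtain ⟨D, hD⟩ := exists_subgroupGrowth_add_le hH
  exact exists_tendsto_root_of_shifted_submultiplicative
    (fun n => by exact_mod_cast one_le_subgroupGrowth H n) D
    fun m n => by exact_mod_cast hD m n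

/-! ### Comparing growth rates -/

theorem tendsto_const_mul_pow_root {C ρ : ℝ} (hC : 0 < C) (hρ : 0 ≤ ρ) :
    Tendsto (fun n : ℕ => (C * ρ ^ n) ^ (1 / (n : ℝ))) atTop (𝓝 ρ) := by
  have h1 : Tendsto (fun n : ℕ => C ^ (1 / (n : ℝ)) * ρ) atTop (𝓝 ρ) := by
    have := (tendsto_const_nhds (x := C)).rpow (tendsto_one_div_atTop_nhds_zero_nat (𝕜 := ℝ))
      (Or.inl hC.ne')
    simpa using this.mul_const ρ
  refine h1.congr' ?_
  filter_upwards [eventually_ne_atTop 0] with n hn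
  rw [Real.mul_rpow hC.le (pow_nonneg hρ n), one_div, Real.pow_rpow_inv_natCast hρ hn]

theorem root_limit_le {a : ℕ → ℝ} {L C ρ : ℝ} (ha : ∀ n, 0 ≤ a n)
    (hL : Tendsto (fun n : ℕ => a n ^ (1 / (n : ℝ))) atTop (𝓝 L)) (hC : 0 < C) (hρ : 0 ≤ ρ)
    (h : ∀ᶠ n in atTop, a n ≤ C * ρ ^ n) : L ≤ ρ := by
  refine le_of_tendsto_of_tendsto hL (tendsto_const_mul_pow_root hC hρ) ?_
  filter_upwards [h] with n hn
  exact Real.rpow_le_rpow (ha n) hn (by positivity)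

theorem le_root_limit {a : ℕ → ℝ} {L C ρ : ℝ}
    (hL : Tendsto (fun n : ℕ => a n ^ (1 / (n : ℝ))) atTop (𝓝 L)) (hC : 0 < C) (hρ : 0 ≤ ρ)
    (h : ∀ᶠ n in atTop, C * ρ ^ n ≤ a n) : ρ ≤ L := by
  refine le_of_tendsto_of_tendsto (tendsto_const_mul_pow_root hC hρ) hL ?_
  filter_upwards [h] with n hn
  exact Real.rpow_le_rpow (by positivity) hn (by positivity)

theorem eventually_le_pow_of_root_limit_lt {a : ℕ → ℝ} {L τ : ℝ} (ha : ∀ n, 0 ≤ a n)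
    (hL : Tendsto (fun n : ℕ => a n ^ (1 / (n : ℝ))) atTop (𝓝 L)) (hτ : L < τ) :
    ∀ᶠ n in atTop, a n ≤ τ ^ n := by
  filter_upwards [hL.eventually_lt_const hτ, eventually_ne_atTop 0] with n hn h0
  calc a n = (a n ^ (1 / (n : ℝ))) ^ n := by
        rw [one_div, Real.rpow_inv_natCast_pow (ha n) h0]
    _ ≤ τ ^ n := pow_le_pow_left₀ (Real.rpow_nonneg (ha n) _) hn.le n

/-! ### Balls in the free group -/

theorem card_ball_le (r n : ℕ) :
    Nat.card {g : FreeGroup (Fin r) // g.norm ≤ n} ≤ (2 * r + 1) ^ n := by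
  have : Nat.card (Fin n → Option (Fin r × Bool)) = (2 * r + 1) ^ n := by
    simp [Nat.card_eq_fintype_card, mul_comm]
  rw [← this]
  refine Nat.card_le_card_of_injective (fun g i => (toWord g.1)[(i : ℕ)]?) ?_
  intro g h heq
  refine Subtype.ext (toWord_injective (List.ext_getElem? fun i => ?_))
  by_cases hi : i < n
  · exact congrFun heq ⟨i, hi⟩
  · rw [List.getElem?_eq_none (g.2.trans (not_lt.1 hi)),
      List.getElem?_eq_none (h.2.trans (not_lt.1 hi))]

theorem card_isReduced_cons {r : ℕ} (L : List (Fin r × Bool)) (hL : IsReduced L) :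
    2 * r - 1 ≤ Nat.card {a : Fin r × Bool // IsReduced (a :: L)} := by
  classical
  cases L with
  | nil =>
    have : Nat.card {a : Fin r × Bool // IsReduced [a]} = 2 * r := by
      rw [Nat.card_congr (Equiv.subtypeUnivEquiv fun _ => IsReduced.singleton)]
      simp [Nat.card_eq_fintype_card, mul_comm]
    omega
  | cons b L =>
    have hne : ∀ a : Fin r × Bool, a ≠ (b.1, !b.2) → IsReduced (a :: b :: L) := by
      intro a ha
      rw [isReduced_cons_cons]
      refine ⟨fun h1 => ?_, hL⟩
      by_contra h2
      exact ha (Prod.ext h1 (by simpa using Bool.eq_not_of_ne h2))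
    have hcard : Nat.card {a : Fin r × Bool // a ≠ (b.1, !b.2)} = 2 * r - 1 := by
      rw [Nat.card_eq_fintype_card, Fintype.card_subtype_compl]
      simp [mul_comm]
    rw [← hcard]
    exact Nat.card_le_card_of_injective (fun a => ⟨a.1, hne a.1 a.2⟩)
      fun a a' h => Subtype.ext (Subtype.mk.inj h)

theorem pow_le_card_isReduced (r n : ℕ) :
    (2 * r - 1) ^ n ≤ Nat.card {L : List (Fin r × Bool) // IsReduced L ∧ L.length = n} := by
  have hfin : ∀ n, Finite {L : List (Fin r × Bool) // IsReduced L ∧ L.length = n} := fun n =>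
    ((List.finite_length_eq (Fin r × Bool) n).subset fun _ h => h.2 :
      {L : List (Fin r × Bool) | IsReduced L ∧ L.length = n}.Finite)
  induction n with
  | zero =>
    have := hfin 0
    have : Nonempty {L : List (Fin r × Bool) // IsReduced L ∧ L.length = 0} :=
      ⟨[], IsReduced.nil, rfl⟩
    rw [pow_zero]
    exact Nat.card_pos
  | succ n ih =>
    have := hfin (n + 1)
    have hemb : ∀ L : {L : List (Fin r × Bool) // IsReduced L ∧ L.length = n},
        Nonempty (Fin (2 * r - 1) ↪ {a : Fin r × Bool // IsReduced (a :: L.1)}) := by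
      classical
      intro L
      refine Function.Embedding.nonempty_of_card_le ?_
      rw [Fintype.card_fin, ← Nat.card_eq_fintype_card]
      exact card_isReduced_cons L.1 L.2.1
    let e := fun L => (hemb L).some
    calc (2 * r - 1) ^ (n + 1)
        ≤ Nat.card {L : List (Fin r × Bool) // IsReduced L ∧ L.length = n} * (2 * r - 1) := by
          rw [pow_succ]
          exact Nat.mul_le_mul_right _ ih
      _ = Nat.card ({L : List (Fin r × Bool) // IsReduced L ∧ L.length = n} ×
            Fin (2 * r - 1)) := by simp
      _ ≤ _ := by
          refine Nat.card_le_card_of_injective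
            (fun x => ⟨(e x.1 x.2).1 :: x.1.1, (e x.1 x.2).2, by simp [x.1.2.2]⟩) ?_
          rintro ⟨L, i⟩ ⟨L', j⟩ h
          obtain ⟨h1, h2⟩ := List.cons.inj (Subtype.mk.inj h)
          obtain rfl : L = L' := Subtype.ext h2
          exact congrArg _ ((e L).injective (Subtype.ext h1))

theorem pow_le_card_ball (r n : ℕ) :
    (2 * r - 1) ^ n ≤ Nat.card {g : FreeGroup (Fin r) // g.norm ≤ n} := by
  have : Finite {g : FreeGroup (Fin r) // g.norm ≤ n} := finite_norm_le n
  refine (pow_le_card_isReduced r n).trans ?_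
  refine Nat.card_le_card_of_injective (fun L => ⟨mk L.1, norm_mk_le.trans L.2.2.le⟩) ?_
  intro L L' h
  have := congrArg (fun x => toWord x.1) h
  simp only [toWord_mk, L.2.1.reduce_eq, L'.2.1.reduce_eq] at this
  exact Subtype.ext this

/-! ### Finite quotients of large girth -/

theorem exists_finite_quotient_of_girth (r R : ℕ) :
    ∃ (Q : Type) (_ : Group Q) (_ : Finite Q) (φ : FreeGroup (Fin r) →* Q),
      ∀ L : List (Fin r × Bool), IsReduced L → L ≠ [] → L.length ≤ R → φ (mk L) ≠ 1 := by
  classical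
  let B := {g : FreeGroup (Fin r) // g.norm ≤ R}
  have : Finite B := finite_norm_le R
  let e : ∀ i : Fin r, {g : B // (of i * g.1).norm ≤ R} ≃ {g : B // ((of i)⁻¹ * g.1).norm ≤ R} :=
    fun i =>
      { toFun := fun g => ⟨⟨of i * g.1.1, g.2⟩, by simpa using g.1.2⟩
        invFun := fun g => ⟨⟨(of i)⁻¹ * g.1.1, g.2⟩, by simpa using g.1.2⟩
        left_inv := fun g => by simp
        right_inv := fun g => by simp }
  have : Fintype B := Fintype.ofFinite B
  let φ : FreeGroup (Fin r) →* Equiv.Perm B := lift fun i => (e i).extendSubtype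
  have hφ : ∀ L : List (Fin r × Bool), IsReduced L → L.length ≤ R →
      (φ (mk L) ⟨1, norm_one.trans_le (Nat.zero_le R)⟩).1 = mk L := by
    intro L
    induction L with
    | nil => intros; rfl
    | cons a L ih =>
      intro hL hR
      have hR' : L.length ≤ R := (Nat.le_succ _).trans hR
      have ih' := ih (hL.infix ⟨[a], [], by simp⟩) hR'
      set x := φ (mk L) ⟨1, norm_one.trans_le (Nat.zero_le R)⟩ with hx
      have hcons : mk (a :: L) = mk [a] * mk L := by rw [mul_mk]; rfl
      have hnorm : (mk (a :: L)).norm ≤ R := norm_mk_le.trans hR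
      rw [hcons, φ.map_mul, Equiv.Perm.mul_apply, ← hx]
      rw [hcons, ← ih'] at hnorm
      obtain ⟨i, b⟩ := a
      cases b with
      | true =>
        have hi : φ (mk [(i, true)]) = (e i).extendSubtype := lift_apply_of
        rw [hi, (e i).extendSubtype_apply_of_mem x hnorm, ← ih']
        rfl
      | false =>
        have hm : mk [(i, false)] = (of i)⁻¹ := rfl
        rw [hm] at hnorm ⊢
        have hi : φ (of i) = (e i).extendSubtype := lift_apply_of
        let y : {g : B // ((of i)⁻¹ * g.1).norm ≤ R} := ⟨x, hnorm⟩
        have hy : φ (of i) ((e i).symm y).1 = x := by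
          rw [hi, (e i).extendSubtype_apply_of_mem _ ((e i).symm y).2]
          simp [y]
        rw [φ.map_inv, Equiv.Perm.inv_eq_iff_eq.2 hy.symm, ← ih']
        rfl
  refine ⟨Equiv.Perm B, inferInstance, inferInstance, φ, fun L hL hne hR h1 => hne ?_⟩
  have := hφ L hL hR
  rw [h1] at this
  have h2 := congrArg toWord this
  simpa [hL.reduce_eq] using h2.symm

/-! ### Stretching the edges of a finite Cayley graph

For a homomorphism `φ` from the free group to a finite group `Q`, words label paths in the Cayley
graph of `Q`, read from right to left.  The `i`-labelled edge leaving the vertex `q` is given the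
colour `q`; subdividing it into `ℓ q` edges labelled `i` yields another graph over the rose,
whose fundamental group is the subgroup `stretchedSubgroup φ ℓ`. -/

section Stretch

variable {r : ℕ} {Q : Type} [Group Q] (φ : FreeGroup (Fin r) →* Q) (ℓ : Q → ℕ)

/-- The colour of the edge crossed when the letter `a` is read at the vertex `q`. -/
def edgeColor (a : Fin r × Bool) (q : Q) : Q :=
  bif a.2 then q else (φ (of a.1))⁻¹ * q

/-- The colours of the edges crossed by the path which starts at `q` and reads a word from
right to left. -/
def pathColors : List (Fin r × Bool) → Q → List Q
  | [], _ => []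
  | a :: L, q => edgeColor φ a (φ (mk L) * q) :: pathColors L q

/-- The word read along the stretched path. -/
def stretchWord : List (Fin r × Bool) → Q → List (Fin r × Bool)
  | [], _ => []
  | a :: L, q => List.replicate (ℓ (edgeColor φ a (φ (mk L) * q))) a ++ stretchWord L q

theorem length_pathColors (L : List (Fin r × Bool)) (q : Q) :
    (pathColors φ L q).length = L.length := by
  induction L with
  | nil => rfl
  | cons a L ih => simp [pathColors, ih]

theorem pathColors_append (A B : List (Fin r × Bool)) (q : Q) :
    pathColors φ (A ++ B) q = pathColors φ A (φ (mk B) * q) ++ pathColors φ B q := by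
  induction A with
  | nil => rfl
  | cons a A ih =>
    have : mk (A ++ B) = mk A * mk B := mul_mk.symm
    simp only [List.cons_append, pathColors, ih, this]
    rw [φ.map_mul, mul_assoc]

theorem length_stretchWord (L : List (Fin r × Bool)) (q : Q) :
    (stretchWord φ ℓ L q).length = ((pathColors φ L q).map ℓ).sum := by
  induction L with
  | nil => rfl
  | cons a L ih => simp [stretchWord, pathColors, ih]

theorem isReduced_replicate_append {a : Fin r × Bool} {M : List (Fin r × Bool)}
    (h : IsReduced (a :: M)) (k : ℕ) : IsReduced (List.replicate (k + 1) a ++ M) := by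
  induction k with
  | zero => exact h
  | succ k ih =>
    rw [List.replicate_succ, List.cons_append] at ih ⊢
    rw [List.replicate_succ, List.cons_append, isReduced_cons_cons]
    exact ⟨fun _ => rfl, ih⟩

variable {ℓ} in
theorem isReduced_stretchWord (hℓ : ∀ q, 1 ≤ ℓ q) {L : List (Fin r × Bool)} (hL : IsReduced L)
    (q : Q) : IsReduced (stretchWord φ ℓ L q) := by
  induction L with
  | nil => exact IsReduced.nil
  | cons a L ih =>
    obtain ⟨k, hk⟩ := Nat.exists_eq_add_of_le' (hℓ (edgeColor φ a (φ (mk L) * q)))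
    rw [stretchWord, hk]
    refine isReduced_replicate_append ?_ k
    have ih' := ih (hL.infix ⟨[a], [], by simp⟩)
    cases L with
    | nil => exact IsReduced.singleton
    | cons b L =>
      obtain ⟨j, hj⟩ := Nat.exists_eq_add_of_le' (hℓ (edgeColor φ b (φ (mk L) * q)))
      rw [stretchWord, hj, List.replicate_succ, List.cons_append] at ih' ⊢
      exact isReduced_cons_cons.2 ⟨(isReduced_cons_cons.1 hL).1, ih'⟩

/-- The action of a generator on vertices paired with stretched words. -/
def stretchPerm (i : Fin r) : Equiv.Perm (Q × FreeGroup (Fin r)) where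
  toFun x := (φ (of i) * x.1, of i ^ ℓ x.1 * x.2)
  invFun x := ((φ (of i))⁻¹ * x.1, (of i ^ ℓ ((φ (of i))⁻¹ * x.1))⁻¹ * x.2)
  left_inv x := by simp
  right_inv x := by simp

theorem mk_replicate_true (i : Fin r) (n : ℕ) :
    mk (List.replicate n (i, true)) = of i ^ n := by
  rw [← toWord_of_pow, mk_toWord]

theorem mk_replicate_false (i : Fin r) (n : ℕ) :
    mk (List.replicate n (i, false)) = (of i ^ n)⁻¹ := by
  rw [← mk_replicate_true, inv_mk]
  simp [invRev]

theorem lift_stretchPerm_mk (L : List (Fin r × Bool)) (q : Q) (g : FreeGroup (Fin r)) :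
    lift (stretchPerm φ ℓ) (mk L) (q, g) = (φ (mk L) * q, mk (stretchWord φ ℓ L q) * g) := by
  induction L with
  | nil =>
    rw [← one_eq_mk, MonoidHom.map_one, MonoidHom.map_one, stretchWord, ← one_eq_mk]
    simp
  | cons a L ih =>
    have hcons : mk (a :: L) = mk [a] * mk L := by rw [mul_mk]; rfl
    rw [hcons, MonoidHom.map_mul, Equiv.Perm.mul_apply, ih, φ.map_mul, stretchWord, ← mul_mk]
    obtain ⟨i, b⟩ := a
    cases b with
    | true =>
      have hi : lift (stretchPerm φ ℓ) (mk [(i, true)]) = stretchPerm φ ℓ i := lift_apply_of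
      have hm : (mk [(i, true)] : FreeGroup (Fin r)) = of i := rfl
      rw [hi, hm, mk_replicate_true]
      simp [stretchPerm, edgeColor, mul_assoc]
    | false =>
      have hi : lift (stretchPerm φ ℓ) (of i) = stretchPerm φ ℓ i := lift_apply_of
      have hm : (mk [(i, false)] : FreeGroup (Fin r)) = (of i)⁻¹ := rfl
      rw [hm, MonoidHom.map_inv, hi, mk_replicate_false, Equiv.Perm.inv_eq_iff_eq]
      simp [stretchPerm, edgeColor, mul_assoc]

/-- The isomorphism from the fundamental group of the Cayley graph to that of the stretched
graph. -/
def stretchHom : φ.ker →* FreeGroup (Fin r) where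
  toFun h := (lift (stretchPerm φ ℓ) h.1 (1, 1)).2
  map_one' := by simp
  map_mul' g h := by
    obtain ⟨⟨L⟩, hg⟩ := g
    obtain ⟨⟨L'⟩, hh⟩ := h
    change (lift (stretchPerm φ ℓ) (mk L * mk L') (1, 1)).2 =
      (lift (stretchPerm φ ℓ) (mk L) (1, 1)).2 * (lift (stretchPerm φ ℓ) (mk L') (1, 1)).2
    have hh' : φ (mk L') = 1 := hh
    rw [MonoidHom.map_mul, Equiv.Perm.mul_apply]
    simp only [lift_stretchPerm_mk, hh', mul_one]

/-- The fundamental group of the stretched Cayley graph. -/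
def stretchedSubgroup : Subgroup (FreeGroup (Fin r)) := (stretchHom φ ℓ).range

theorem fg_stretchedSubgroup [Finite Q] : (stretchedSubgroup φ ℓ).FG := by
  have : φ.ker.FiniteIndex := inferInstance
  have : Group.FG φ.ker := inferInstance
  exact (Group.fg_iff_subgroup_fg _).1 (Group.fg_range (stretchHom φ ℓ))

/-- The length of the stretched closed path defined by an element of the kernel. -/
def stretchedLength (h : FreeGroup (Fin r)) : ℕ := ((pathColors φ (toWord h) 1).map ℓ).sum

variable {ℓ}

theorem norm_stretchHom (hℓ : ∀ q, 1 ≤ ℓ q) (h : φ.ker) :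
    (stretchHom φ ℓ h).norm = stretchedLength φ ℓ h.1 := by
  have : stretchHom φ ℓ h = mk (stretchWord φ ℓ (toWord h.1) 1) := by
    change (lift (stretchPerm φ ℓ) h.1 (1, 1)).2 = _
    conv_lhs => rw [← mk_toWord (x := h.1), lift_stretchPerm_mk]
    exact mul_one _
  rw [this, FreeGroup.norm, toWord_mk, (isReduced_stretchWord φ hℓ isReduced_toWord 1).reduce_eq,
    length_stretchWord, stretchedLength]

omit [Group Q] in
theorem length_le_sum_map (hℓ : ∀ q, 1 ≤ ℓ q) (c : List Q) : c.length ≤ (c.map ℓ).sum := by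
  induction c with
  | nil => simp
  | cons a c ih =>
    have := hℓ a
    simp only [List.length_cons, List.map_cons, List.sum_cons]
    omega

theorem norm_le_stretchedLength (hℓ : ∀ q, 1 ≤ ℓ q) (h : FreeGroup (Fin r)) :
    h.norm ≤ stretchedLength φ ℓ h :=
  (length_pathColors φ _ 1).symm.trans_le (length_le_sum_map hℓ _)

theorem stretchHom_injective (hℓ : ∀ q, 1 ≤ ℓ q) : Function.Injective (stretchHom φ ℓ) := by
  rw [injective_iff_map_eq_one]
  intro h hh
  have h1 := norm_le_stretchedLength φ hℓ h.1
  rw [← norm_stretchHom φ hℓ, hh, FreeGroup.norm_one, Nat.le_zero, FreeGroup.norm_eq_zero] at h1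
  exact Subtype.ext h1

theorem finite_stretchedLength_le (hℓ : ∀ q, 1 ≤ ℓ q) (n : ℕ) :
    {h | h ∈ φ.ker ∧ stretchedLength φ ℓ h ≤ n}.Finite :=
  (finite_norm_le n).subset fun h hh => (norm_le_stretchedLength φ hℓ h).trans hh.2

theorem subgroupGrowth_stretchedSubgroup (hℓ : ∀ q, 1 ≤ ℓ q) (n : ℕ) :
    subgroupGrowth (stretchedSubgroup φ ℓ) n =
      {h | h ∈ φ.ker ∧ stretchedLength φ ℓ h ≤ n}.ncard := by
  rw [← Nat.card_coe_set_eq, subgroupGrowth]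
  symm
  refine Nat.card_congr (Equiv.ofBijective
    (fun h => ⟨stretchHom φ ℓ ⟨h.1, h.2.1⟩, ⟨_, rfl⟩,
      (norm_stretchHom φ hℓ _).trans_le h.2.2⟩) ⟨?_, ?_⟩)
  · intro h h' heq
    have := stretchHom_injective φ hℓ (Subtype.mk.inj heq)
    exact Subtype.ext (Subtype.mk.inj this)
  · rintro ⟨_, ⟨h, rfl⟩, hn⟩
    exact ⟨⟨h.1, h.2, (norm_stretchHom φ hℓ h).symm.trans_le hn⟩, rfl⟩

end Stretch

/-! ### Growth rates of stretched subgroups -/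

section Rate

variable {r : ℕ} {Q : Type} [Group Q] (φ : FreeGroup (Fin r) →* Q) {ℓ : Q → ℕ}

omit [Group Q] in
theorem sum_map_update [DecidableEq Q] (e : Q) (c : List Q) :
    (c.map (Function.update ℓ e (ℓ e + 1))).sum = (c.map ℓ).sum + c.count e := by
  induction c with
  | nil => simp
  | cons a c ih =>
    simp only [List.map_cons, List.sum_cons, ih, List.count_cons, Function.update_apply,
      beq_iff_eq]
    split_ifs with h
    · subst h; ring
    · ring

omit [Group Q] in
theorem sum_count_le_length [DecidableEq Q] (I : Finset Q) (c : List Q) :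
    ∑ e ∈ I, c.count e ≤ c.length := by
  induction c with
  | nil => simp
  | cons a c ih =>
    simp only [List.count_cons, Finset.sum_add_distrib, List.length_cons, beq_iff_eq]
    refine add_le_add ih ?_
    rw [Finset.sum_ite_eq]
    split_ifs <;> simp

/-- Some edge colour is crossed rarely by a given path, so stretching it further hardly changes
the length of the path. -/
theorem subgroupGrowth_le_sum_update [DecidableEq Q] (hℓ : ∀ q, 1 ≤ ℓ q) {I : Finset Q} {M : ℕ}
    (hM0 : 0 < M) (hM : M ≤ I.card) (n : ℕ) :
    subgroupGrowth (stretchedSubgroup φ ℓ) n ≤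
      ∑ e ∈ I, subgroupGrowth (stretchedSubgroup φ (Function.update ℓ e (ℓ e + 1)))
        (n + n / M) := by
  have hu : ∀ e q, 1 ≤ Function.update ℓ e (ℓ e + 1) q := by
    intro e q
    rw [Function.update_apply]
    split_ifs
    · simp
    · exact hℓ q
  simp only [subgroupGrowth_stretchedSubgroup φ hℓ, subgroupGrowth_stretchedSubgroup φ (hu _)]
  refine le_trans (Set.ncard_le_ncard ?_ ?_) (Finset.set_ncard_biUnion_le I _)
  · rintro h ⟨hker, hn⟩
    have hsum : ∑ e ∈ I, (pathColors φ (toWord h) 1).count e ≤ n :=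
      ((sum_count_le_length I _).trans (length_le_sum_map hℓ _)).trans hn
    obtain ⟨e, he, hcount⟩ : ∃ e ∈ I, (pathColors φ (toWord h) 1).count e * M ≤ n := by
      by_contra! hlt
      have hI : I.Nonempty := Finset.card_pos.1 (hM0.trans_le hM)
      have h1 := Finset.sum_lt_sum_of_nonempty hI hlt
      rw [← Finset.sum_mul, Finset.sum_const, smul_eq_mul] at h1
      have h2 := (h1.trans_le (Nat.mul_le_mul_right M hsum)).trans_le (Nat.mul_le_mul_left n hM)
      rw [mul_comm] at h2
      exact lt_irrefl _ h2
    refine Set.mem_biUnion he ⟨hker, ?_⟩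
    rw [stretchedLength, sum_map_update]
    exact add_le_add hn ((Nat.le_div_iff_mul_le hM0).2 hcount)
  · exact I.finite_toSet.biUnion fun e _ => finite_stretchedLength_le φ (hu e) _

theorem growth_rate_le_of_update [DecidableEq Q] (hℓ : ∀ q, 1 ≤ ℓ q) {I : Finset Q} {M : ℕ}
    (hM0 : 0 < M) (hM : M ≤ I.card) {L τ : ℝ} (hτ : 1 ≤ τ)
    (hL : Tendsto (fun n : ℕ => (subgroupGrowth (stretchedSubgroup φ ℓ) n : ℝ) ^ (1 / (n : ℝ)))
      atTop (𝓝 L))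
    (hI : ∀ e ∈ I, ∃ L' < τ, Tendsto (fun n : ℕ =>
      (subgroupGrowth (stretchedSubgroup φ (Function.update ℓ e (ℓ e + 1))) n : ℝ) ^ (1 / (n : ℝ)))
      atTop (𝓝 L')) :
    L ≤ τ ^ (1 + 1 / (M : ℝ)) := by
  have hτ0 : 0 < τ := one_pos.trans_le hτ
  have hev : ∀ᶠ m in atTop, ∀ e ∈ I,
      (subgroupGrowth (stretchedSubgroup φ (Function.update ℓ e (ℓ e + 1))) m : ℝ) ≤ τ ^ m := by
    rw [Filter.eventually_all_finset]
    intro e he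
    obtain ⟨L', hL', hlim⟩ := hI e he
    exact eventually_le_pow_of_root_limit_lt (fun _ => Nat.cast_nonneg _) hlim hL'
  have hcard : (0 : ℝ) < I.card := by exact_mod_cast hM0.trans_le hM
  refine root_limit_le (fun _ => Nat.cast_nonneg _) hL hcard (by positivity) ?_
  have hshift : Tendsto (fun n : ℕ => n + n / M) atTop atTop :=
    tendsto_atTop_mono (fun n => Nat.le_add_right n _) tendsto_id
  filter_upwards [hshift.eventually hev] with n hn
  calc (subgroupGrowth (stretchedSubgroup φ ℓ) n : ℝ)
      ≤ ∑ e ∈ I, (subgroupGrowth (stretchedSubgroup φ (Function.update ℓ e (ℓ e + 1)))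
          (n + n / M) : ℝ) := by exact_mod_cast subgroupGrowth_le_sum_update φ hℓ hM0 hM n
    _ ≤ ∑ e ∈ I, τ ^ (n + n / M) := Finset.sum_le_sum hn
    _ = I.card * τ ^ (n + n / M) := by rw [Finset.sum_const, nsmul_eq_mul]
    _ ≤ I.card * (τ ^ (1 + 1 / (M : ℝ))) ^ n := by
        refine mul_le_mul_of_nonneg_left ?_ hcard.le
        rw [← Real.rpow_natCast, ← Real.rpow_mul_natCast hτ0.le]
        refine Real.rpow_le_rpow_of_exponent_le hτ ?_
        have : ((n / M : ℕ) : ℝ) ≤ n / M := Nat.cast_div_le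
        push_cast
        calc (n : ℝ) + ((n / M : ℕ) : ℝ) ≤ n + n / M := by linarith
          _ = (1 + 1 / (M : ℝ)) * n := by ring

theorem two_mul_sub_one_le_growth_rate [Finite Q] {L : ℝ} (hr : 1 ≤ r)
    (hL : Tendsto (fun n : ℕ =>
      (subgroupGrowth (stretchedSubgroup φ fun _ => 1) n : ℝ) ^ (1 / (n : ℝ))) atTop (𝓝 L)) :
    2 * (r : ℝ) - 1 ≤ L := by
  have := Fintype.ofFinite Q
  have hone : ∀ q : Q, 1 ≤ (fun _ => 1 : Q → ℕ) q := fun _ => le_rfl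
  have hlen : ∀ h, stretchedLength φ (fun _ => 1) h = h.norm := by
    intro h
    simp [stretchedLength, length_pathColors, FreeGroup.norm]
  choose s hs using fun q : φ.range => q.2
  have hsφ : ∀ w, φ (s ⟨φ w, w, rfl⟩) = φ w := fun w => hs _
  have := Fintype.ofFinite φ.range
  let D := Finset.univ.sup fun q => (s q).norm
  have hD : ∀ q, (s q).norm ≤ D := fun q =>
    Finset.le_sup (f := fun q => (s q).norm) (Finset.mem_univ q)
  have hcount : ∀ n, (2 * r - 1) ^ n ≤
      subgroupGrowth (stretchedSubgroup φ fun _ => 1) (n + D) * Nat.card Q := by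
    intro n
    refine (pow_le_card_ball r n).trans ?_
    rw [subgroupGrowth_stretchedSubgroup φ hone, ← Nat.card_coe_set_eq, ← Nat.card_prod]
    have := (finite_stretchedLength_le φ hone (n + D)).to_subtype
    refine Nat.card_le_card_of_injective
      (fun w => (⟨w.1 * (s ⟨φ w.1, w.1, rfl⟩)⁻¹, ?_, ?_⟩, φ w.1)) ?_
    · rw [MonoidHom.mem_ker, φ.map_mul, φ.map_inv, hsφ, mul_inv_cancel]
    · rw [hlen]
      exact (FreeGroup.norm_mul_le _ _).trans <|
        add_le_add w.2 (norm_inv_eq.trans_le (hD _))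
    · intro w w' h
      obtain ⟨h1, h2⟩ := Prod.mk.inj h
      have h1 := Subtype.mk.inj h1
      have h3 : (⟨φ w.1, w.1, rfl⟩ : φ.range) = ⟨φ w'.1, w'.1, rfl⟩ := Subtype.ext h2
      rw [h3] at h1
      exact Subtype.ext (mul_right_cancel h1)
  have hcast : ((2 * r - 1 : ℕ) : ℝ) = 2 * (r : ℝ) - 1 := by
    rw [Nat.cast_sub (by omega)]
    simp
  rw [← hcast]
  set ρ : ℝ := ((2 * r - 1 : ℕ) : ℝ) with hρ
  have hρ1 : 1 ≤ ρ := by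
    rw [hρ]
    exact_mod_cast (by omega : 1 ≤ 2 * r - 1)
  have hρ0 : 0 < ρ := one_pos.trans_le hρ1
  have hQ : (0 : ℝ) < Nat.card Q := by exact_mod_cast Nat.card_pos
  refine le_root_limit (C := (ρ ^ D * Nat.card Q)⁻¹) hL (by positivity) hρ0.le ?_
  filter_upwards [eventually_ge_atTop D] with n hn
  obtain ⟨m, rfl⟩ := Nat.exists_eq_add_of_le' hn
  rw [inv_mul_le_iff₀ (by positivity), pow_add]
  have : ρ ^ m ≤ subgroupGrowth (stretchedSubgroup φ fun _ => 1) (m + D) * (Nat.card Q : ℝ) := by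
    rw [hρ]
    exact_mod_cast hcount m
  calc ρ ^ m * ρ ^ D
      ≤ subgroupGrowth (stretchedSubgroup φ fun _ => 1) (m + D) * (Nat.card Q : ℝ) * ρ ^ D := by
        gcongr
    _ = _ := by ring

theorem exists_edgeColor_eq (a : Fin r × Bool) (L : List (Fin r × Bool)) (q : Q) :
    ∃ S, (S = L ∨ S = a :: L) ∧ edgeColor φ a (φ (mk L) * q) = φ (mk S) * q := by
  obtain ⟨i, b⟩ := a
  cases b with
  | true => exact ⟨L, Or.inl rfl, rfl⟩
  | false =>
    refine ⟨_, Or.inr rfl, ?_⟩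
    have : mk ((i, false) :: L) = (of i)⁻¹ * mk L := rfl
    rw [this, φ.map_mul, φ.map_inv, mul_assoc]
    rfl

theorem exists_suffix_of_mem_pathColors {A : List (Fin r × Bool)} {q c : Q}
    (h : c ∈ pathColors φ A q) : ∃ S, S <:+ A ∧ c = φ (mk S) * q := by
  induction A with
  | nil => simp [pathColors] at h
  | cons a A ih =>
    rcases List.mem_cons.1 h with rfl | h
    · obtain ⟨S, hS, heq⟩ := exists_edgeColor_eq φ a A q
      refine ⟨S, ?_, heq⟩
      rcases hS with rfl | rfl
      · exact List.suffix_cons _ _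
      · exact List.suffix_rfl
    · obtain ⟨S, hS, heq⟩ := ih h
      exact ⟨S, hS.trans (List.suffix_cons _ _), heq⟩

/-- In a Cayley graph of large girth, short reduced paths cross many colours. -/
theorem le_card_toFinset_pathColors [DecidableEq Q] {R : ℕ}
    (girth : ∀ L : List (Fin r × Bool), IsReduced L → L ≠ [] → L.length ≤ R → φ (mk L) ≠ 1)
    (k : ℕ) (hk : 2 * k ≤ R) {A : List (Fin r × Bool)} (hA : IsReduced A)
    (hlen : A.length = 2 * k) (q : Q) : k ≤ (pathColors φ A q).toFinset.card := by
  induction k generalizing A with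
  | zero => exact Nat.zero_le _
  | succ k ih =>
    match A, hlen with
    | a :: b :: A, hlen =>
      simp only [List.length_cons] at hlen
      have ih' := ih (A := A) (by omega) (hA.infix ⟨[a, b], [], by simp⟩) (by omega)
      have hnot : edgeColor φ a (φ (mk (b :: A)) * q) ∉ pathColors φ A q := by
        intro hmem
        obtain ⟨S, ⟨U, rfl⟩, hS⟩ := exists_suffix_of_mem_pathColors φ hmem
        obtain ⟨S', hS', heq⟩ := exists_edgeColor_eq φ a (b :: (U ++ S)) q
        have hcl : ∀ X, X ≠ [] → X <:+: a :: b :: (U ++ S) → X.length ≤ R →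
            S' ≠ X ++ S := by
          rintro X hX hinf hXR rfl
          refine girth X (hA.infix hinf) hX hXR ?_
          rw [hS, ← mul_mk, φ.map_mul, mul_assoc] at heq
          exact right_eq_mul.1 heq
        simp only [List.length_append] at hlen
        rcases hS' with rfl | rfl
        · exact hcl (b :: U) (by simp) ⟨[a], S, by simp⟩ (by simp; omega) (by simp)
        · exact hcl (a :: b :: U) (by simp) ⟨[], S, by simp⟩ (by simp; omega) (by simp)
      calc k + 1 ≤ (pathColors φ A q).toFinset.card + 1 := by omega
        _ = (insert (edgeColor φ a (φ (mk (b :: A)) * q)) (pathColors φ A q).toFinset).card := by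
          rw [Finset.card_insert_of_notMem (by simpa using hnot)]
        _ ≤ _ := by
          refine Finset.card_le_card ?_
          intro x hx
          simp only [Finset.mem_insert, List.mem_toFinset, pathColors, List.mem_cons] at hx ⊢
          tauto

theorem mul_le_sum_map_pathColors [DecidableEq Q] [Fintype Q] {k K : ℕ}
    (girth : ∀ L : List (Fin r × Bool), IsReduced L → L ≠ [] → L.length ≤ 2 * k → φ (mk L) ≠ 1)
    (hshort : (Finset.univ.filter fun q => ℓ q < K).card < k) (j : ℕ) {L : List (Fin r × Bool)}
    (hL : IsReduced L) (hlen : 2 * k * j ≤ L.length) (q : Q) :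
    K * j ≤ ((pathColors φ L q).map ℓ).sum := by
  induction j generalizing L with
  | zero => simp
  | succ j ih =>
    have hdrop := ih (L := L.drop (2 * k)) (hL.infix (List.drop_suffix _ _).isInfix)
      (by rw [List.length_drop]; rw [mul_add] at hlen; omega)
    have htake : IsReduced (L.take (2 * k)) := hL.infix (List.take_prefix _ _).isInfix
    have hcard := le_card_toFinset_pathColors φ girth k le_rfl htake
      (by rw [List.length_take]; rw [mul_add] at hlen; omega) (φ (mk (L.drop (2 * k))) * q)
    obtain ⟨c, hc, hKc⟩ : ∃ c ∈ pathColors φ (L.take (2 * k)) (φ (mk (L.drop (2 * k))) * q),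
        K ≤ ℓ c := by
      by_contra! hlt
      refine absurd (hcard.trans (Finset.card_le_card fun c hc => ?_)) (not_le.2 hshort)
      simpa using hlt c (List.mem_toFinset.1 hc)
    have hsum := List.single_le_sum (fun _ _ => Nat.zero_le _) _ (List.mem_map_of_mem (f := ℓ) hc)
    rw [← List.take_append_drop (2 * k) L, pathColors_append, List.map_append, List.sum_append]
    rw [mul_add, mul_one, add_comm]
    exact add_le_add (hKc.trans hsum) hdrop

theorem growth_rate_le_of_few_short [DecidableEq Q] [Fintype Q] {k K : ℕ} (hℓ : ∀ q, 1 ≤ ℓ q)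
    (girth : ∀ L : List (Fin r × Bool), IsReduced L → L ≠ [] → L.length ≤ 2 * k → φ (mk L) ≠ 1)
    (hshort : (Finset.univ.filter fun q => ℓ q < K).card < k) (hK : 0 < K) {L : ℝ}
    (hL : Tendsto (fun n : ℕ => (subgroupGrowth (stretchedSubgroup φ ℓ) n : ℝ) ^ (1 / (n : ℝ)))
      atTop (𝓝 L)) :
    L ≤ ((2 * r + 1 : ℝ) ^ (2 * k)) ^ (1 / (K : ℝ)) := by
  have hk : 0 < k := by omega
  have hcount : ∀ n, subgroupGrowth (stretchedSubgroup φ ℓ) n ≤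
      (2 * r + 1) ^ (2 * k * (n / K + 1)) := by
    intro n
    refine le_trans ?_ (card_ball_le r _)
    rw [subgroupGrowth_stretchedSubgroup φ hℓ]
    refine Set.ncard_le_ncard ?_ (finite_norm_le _)
    rintro h ⟨-, hn⟩
    have h1 := mul_le_sum_map_pathColors φ girth hshort (h.norm / (2 * k)) isReduced_toWord
      (Nat.mul_div_le h.norm (2 * k)) 1
    have h2 : h.norm / (2 * k) ≤ n / K :=
      (Nat.le_div_iff_mul_le hK).2 (by rw [mul_comm]; exact h1.trans hn)
    have h3 := Nat.lt_mul_div_succ h.norm (by omega : 0 < 2 * k)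
    exact h3.le.trans (Nat.mul_le_mul_left _ (by omega))
  set B : ℝ := (2 * r + 1 : ℝ) ^ (2 * k) with hB
  have hB1 : 1 ≤ B := one_le_pow₀ (by linarith [Nat.cast_nonneg (α := ℝ) r])
  have hB0 : 0 < B := one_pos.trans_le hB1
  refine root_limit_le (fun _ => Nat.cast_nonneg _) hL hB0 (by positivity)
    (Eventually.of_forall fun n => ?_)
  calc (subgroupGrowth (stretchedSubgroup φ ℓ) n : ℝ)
      ≤ (2 * r + 1 : ℝ) ^ (2 * k * (n / K + 1)) := by exact_mod_cast hcount n
    _ = B * B ^ (n / K) := by rw [pow_mul, ← hB, pow_succ']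
    _ ≤ B * (B ^ (1 / (K : ℝ))) ^ n := by
        refine mul_le_mul_of_nonneg_left ?_ hB0.le
        rw [← Real.rpow_natCast, ← Real.rpow_mul_natCast hB0.le]
        refine Real.rpow_le_rpow_of_exponent_le hB1 ?_
        have : ((n / K : ℕ) : ℝ) ≤ n / K := Nat.cast_div_le
        rwa [one_div_mul_eq_div]

end Rate

/-- The set of growth rates of finitely generated subgroups of `F_r` is dense
in `[1, 2r-1]`. -/
theorem stmt_0 (r : ℕ) (hr : 2 ≤ r) (α : ℝ) (hα1 : 1 ≤ α) (hα2 : α ≤ 2 * (r : ℝ) - 1)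
    (ε : ℝ) (hε : 0 < ε) :
    ∃ (H : Subgroup (FreeGroup (Fin r))) (L : ℝ), H.FG ∧
      Tendsto (fun n : ℕ => (subgroupGrowth H n : ℝ) ^ (1 / (n : ℝ))) atTop (𝓝 L) ∧
      |L - α| < ε := by
  classical
  by_contra! hgap
  have hα0 : 0 < α := one_pos.trans_le hα1
  obtain ⟨M, hM, hM0⟩ : ∃ M : ℕ, α ^ (1 + 1 / (M : ℝ)) < α + ε ∧ 0 < M := by
    have h1 : Tendsto (fun M : ℕ => α ^ (1 + 1 / (M : ℝ))) atTop (𝓝 α) := by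
      have := (tendsto_const_nhds (x := α)).rpow
        ((tendsto_one_div_atTop_nhds_zero_nat (𝕜 := ℝ)).const_add 1) (Or.inl hα0.ne')
      simpa using this
    exact ((h1.eventually_lt_const (by linarith)).and (eventually_gt_atTop 0)).exists
  obtain ⟨K, hK, hK0⟩ : ∃ K : ℕ,
      ((2 * r + 1 : ℝ) ^ (2 * M)) ^ (1 / (K : ℝ)) < 1 + ε ∧ 0 < K := by
    have h1 : Tendsto (fun K : ℕ => ((2 * r + 1 : ℝ) ^ (2 * M)) ^ (1 / (K : ℝ))) atTop (𝓝 1) := by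
      have := (tendsto_const_nhds (x := (2 * r + 1 : ℝ) ^ (2 * M))).rpow
        (tendsto_one_div_atTop_nhds_zero_nat (𝕜 := ℝ)) (Or.inl (by positivity))
      simpa using this
    exact ((h1.eventually_lt_const (by linarith)).and (eventually_gt_atTop 0)).exists
  obtain ⟨Q, _, _, φ, girth⟩ := exists_finite_quotient_of_girth r (2 * M)
  have := Fintype.ofFinite Q
  have hsmall : ∀ (N : ℕ) (ℓ : Q → ℕ), (∀ q, 1 ≤ ℓ q) → ∑ q, (K - ℓ q) = N → ∀ L : ℝ,
      Tendsto (fun n : ℕ => (subgroupGrowth (stretchedSubgroup φ ℓ) n : ℝ) ^ (1 / (n : ℝ)))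
        atTop (𝓝 L) → L < α := by
    intro N
    induction N using Nat.strong_induction_on with
    | _ N ih =>
      intro ℓ hℓ hN L hL
      have hlt : L < α + ε := by
        rcases lt_or_ge (Finset.univ.filter fun q => ℓ q < K).card M with hI | hI
        · have := growth_rate_le_of_few_short φ hℓ girth hI hK0 hL
          linarith
        · refine (growth_rate_le_of_update φ hℓ hM0 hI hα1 hL fun e he => ?_).trans_lt hM
          obtain ⟨L', -, hL'⟩ :=
            exists_growth_rate (fg_stretchedSubgroup φ (Function.update ℓ e (ℓ e + 1)))
          have heK : ℓ e < K := (Finset.mem_filter.1 he).2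
          refine ⟨L', ih _ ?_ _ (fun q => ?_) rfl L' hL', hL'⟩
          · rw [← hN]
            refine Finset.sum_lt_sum (fun q _ => ?_) ⟨e, Finset.mem_univ e, ?_⟩
            · rw [Function.update_apply]
              split_ifs with h
              · subst h; omega
              · rfl
            · rw [Function.update_self]
              omega
          · rw [Function.update_apply]
            split_ifs
            · simp
            · exact hℓ q
      have := hgap _ L (fg_stretchedSubgroup φ ℓ) hL
      rcases le_abs.1 this with h | h <;> linarith
  obtain ⟨L, -, hL⟩ := exists_growth_rate (fg_stretchedSubgroup φ fun _ => 1)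
  have h1 := two_mul_sub_one_le_growth_rate φ (by omega) hL
  have h2 := hsmall _ _ (fun _ => le_rfl) rfl L hL
  linarith
end

section
/- For every integer r ≥ 2, every real α with 1 ≤ α ≤ 2r−1, and every ε > 0, there exist an infinite tree T with all vertex degrees in {2, …, 2r}, a finite connected simple graph G, a graph covering map from T onto G, a vertex o of T, and a real L such that the sequence n ↦ |B_n(T, o)|^{1/n} tends to L as n → ∞ and |L − α| < ε. In other words, the growth rates of strongly periodic trees with degrees in {2, …, 2r} are dense in [1, 2r−1]. -/
open Filter Topology

/-- `f` is a graph covering map from `T` to `G`: a graph homomorphism mapping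
the neighborhood of each vertex `v` bijectively onto the neighborhood of `f v`. -/
def IsGraphCovering {V W : Type*} (T : SimpleGraph V) (G : SimpleGraph W) (f : V → W) : Prop :=
  (∀ u v : V, T.Adj u v → G.Adj (f u) (f v)) ∧
  ∀ v : V, Set.BijOn f (T.neighborSet v) (G.neighborSet (f v))

namespace StarTree

section Words

variable {C Q : Type}

/-- A word is reduced if no two consecutive letters agree. -/
def Reduced (w : List C) : Prop := w.IsChain (· ≠ ·)

lemma reduced_nil : Reduced ([] : List C) := List.isChain_nil

lemma reduced_singleton (c : C) : Reduced [c] := List.isChain_singleton c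

lemma reduced_cons {c : C} {w : List C} : Reduced (c :: w) ↔ w.head? ≠ some c ∧ Reduced w := by
  unfold Reduced
  rw [List.isChain_cons]
  cases w <;> simp [eq_comm]

lemma Reduced.tail {w : List C} (h : Reduced w) : Reduced w.tail := List.IsChain.tail h

lemma reduced_append_left {u v : List C} (h : Reduced (u ++ v)) : Reduced u :=
  (List.isChain_append.1 h).1

lemma reduced_append_right {u v : List C} (h : Reduced (u ++ v)) : Reduced v :=
  (List.isChain_append.1 h).2.1

/-- Left multiplication by the involution `c` on reduced words. -/
def toggle [DecidableEq C] (c : C) : List C → List C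
  | [] => [c]
  | a :: t => if a = c then t else c :: a :: t

lemma toggle_of_ne [DecidableEq C] {c : C} {w : List C} (h : w.head? ≠ some c) :
    toggle c w = c :: w := by
  cases w with
  | nil => rfl
  | cons a t => simp at h; simp [toggle, h]

lemma toggle_cons_self [DecidableEq C] (c : C) (w : List C) : toggle c (c :: w) = w := by
  simp [toggle]

lemma exists_cons_of_head? {c : C} {w : List C} (h : w.head? = some c) : ∃ t, w = c :: t := by
  cases w with
  | nil => simp at h
  | cons a t => simp at h; exact ⟨t, by rw [h]⟩

lemma toggle_reduced [DecidableEq C] (c : C) {w : List C} (h : Reduced w) :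
    Reduced (toggle c w) := by
  by_cases hc : w.head? = some c
  · obtain ⟨t, rfl⟩ := exists_cons_of_head? hc
    rw [toggle_cons_self]
    exact (reduced_cons.1 h).2
  · rw [toggle_of_ne hc]
    exact reduced_cons.2 ⟨hc, h⟩

lemma toggle_toggle [DecidableEq C] (c : C) {w : List C} (h : Reduced w) :
    toggle c (toggle c w) = w := by
  by_cases hc : w.head? = some c
  · obtain ⟨t, rfl⟩ := exists_cons_of_head? hc
    rw [toggle_cons_self, toggle_of_ne (reduced_cons.1 h).1]
  · rw [toggle_of_ne hc, toggle_cons_self]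

/-- The action of a word, rightmost letter first. -/
def act (σ : C → Q → Q) (w : List C) (q : Q) : Q := w.foldr σ q

/-- The cost of the path spelled by a word from `q`, when crossing the edge between
`x` and `y` costs `k x + 1 + k y`. -/
def len (σ : C → Q → Q) (k : Q → ℕ) (q : Q) : List C → ℕ
  | [] => 0
  | c :: w => len σ k q w + (k (act σ w q) + 1 + k (σ c (act σ w q)))

variable {σ : C → Q → Q} {k : Q → ℕ}

@[simp] lemma act_nil (q : Q) : act σ [] q = q := rfl

@[simp] lemma act_cons (c : C) (w : List C) (q : Q) : act σ (c :: w) q = σ c (act σ w q) := rfl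

lemma act_append (u v : List C) (q : Q) : act σ (u ++ v) q = act σ u (act σ v q) := by
  simp [act]

lemma len_append (u v : List C) (q : Q) :
    len σ k q (u ++ v) = len σ k (act σ v q) u + len σ k q v := by
  induction u with
  | nil => simp [len]
  | cons c u ih => simp only [List.cons_append, len, ih, act_append]; ring

lemma length_le_len (q : Q) (w : List C) : w.length ≤ len σ k q w := by
  induction w with
  | nil => simp
  | cons c w ih => simp only [List.length_cons, len]; omega

lemma len_const (K : ℕ) (q : Q) (w : List C) :
    len σ (fun _ => K) q w = (2 * K + 1) * w.length := by
  induction w with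
  | nil => simp [len]
  | cons c w ih => simp only [List.length_cons, len, ih]; ring

lemma act_toggle [DecidableEq C] (hσ : ∀ c q, σ c (σ c q) = q) (c : C) (w : List C) (q : Q) :
    act σ (toggle c w) q = σ c (act σ w q) := by
  by_cases hc : w.head? = some c
  · obtain ⟨t, rfl⟩ := exists_cons_of_head? hc
    simp [toggle_cons_self, hσ]
  · rw [toggle_of_ne hc, act_cons]

/-- Short nonempty reduced words act without fixed points. -/
def GirthGT (σ : C → Q → Q) (R : ℕ) : Prop :=
  ∀ w : List C, Reduced w → w ≠ [] → w.length ≤ R → ∀ q, act σ w q ≠ q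

/-- The number of times the path spelled by a word from `q` is at `p`. -/
def visits [DecidableEq Q] (σ : C → Q → Q) (p q : Q) : List C → ℕ
  | [] => if q = p then 1 else 0
  | c :: w => visits σ p q w + if σ c (act σ w q) = p then 1 else 0

lemma visits_le [DecidableEq Q] {R : ℕ} (hR : GirthGT σ R) (p q : Q) {w : List C}
    (hw : Reduced w) : (R + 1) * visits σ p q w ≤ w.length + (R + 1) := by
  suffices H : ∃ t ≤ w.length, (R + 1) * visits σ p q w + t ≤ w.length + (R + 1) ∧
      (visits σ p q w = 0 ∨ ∃ u v, w = u ++ v ∧ u.length = t ∧ act σ v q = p) by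
    obtain ⟨t, -, h, -⟩ := H
    omega
  induction w with
  | nil =>
    refine ⟨0, le_rfl, ?_, ?_⟩
    · simp only [visits]; split_ifs <;> simp
    · by_cases h : q = p
      · exact .inr ⟨[], [], rfl, rfl, h⟩
      · exact .inl (by simp [visits, h])
  | cons c w ih =>
    obtain ⟨t, ht, h1, h2⟩ := ih (reduced_cons.1 hw).2
    by_cases hc : σ c (act σ w q) = p
    · refine ⟨0, by simp, ?_, .inr ⟨[], c :: w, rfl, rfl, hc⟩⟩
      simp only [visits, hc, if_true, List.length_cons, mul_add]
      rcases h2 with h2 | ⟨u, v, rfl, hu, hv⟩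
      · rw [h2]; omega
      · have : ¬ (c :: u).length ≤ R := fun hlen =>
          hR (c :: u) (reduced_append_left (v := v) hw) (by simp) hlen p
            (by rw [act_cons, ← hv, ← act_append, hc, hv])
        simp only [List.length_cons] at this
        omega
    · refine ⟨t + 1, by simpa using ht, ?_, ?_⟩
      · simp only [visits, hc, if_false, List.length_cons, add_zero]; omega
      · rcases h2 with h2 | ⟨u, v, rfl, hu, hv⟩
        · exact .inl (by simp [visits, hc, h2])
        · exact .inr ⟨c :: u, v, rfl, by simp [hu], hv⟩

lemma len_add_single_le [DecidableEq Q] (p q : Q) (w : List C) :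
    len σ (k + Pi.single p 1) q w + (if act σ w q = p then 1 else 0)
      ≤ len σ k q w + 2 * visits σ p q w := by
  induction w with
  | nil => by_cases h : q = p <;> simp [len, visits, h]
  | cons c w ih =>
    simp only [len, visits, act_cons, Pi.add_apply, Pi.single_apply]
    by_cases h1 : act σ w q = p <;> by_cases h2 : σ c (act σ w q) = p <;>
      simp only [h1, h2, if_true, if_false] at ih ⊢ <;> omega

/-- Reduced words that are short from some starting point. -/
def short (σ : C → Q → Q) (k : Q → ℕ) (n : ℕ) : Set (List C) :=
  {w | Reduced w ∧ ∃ q, len σ k q w ≤ n}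

lemma short_finite [Finite C] (n : ℕ) : (short σ k n).Finite :=
  (List.finite_length_le C n).subset fun _ ⟨_, q, h⟩ => (length_le_len q _).trans h

lemma nil_mem_short [Nonempty Q] (n : ℕ) : [] ∈ short σ k n :=
  ⟨reduced_nil, Classical.arbitrary Q, Nat.zero_le _⟩

lemma short_ncard_pos [Finite C] [Nonempty Q] (n : ℕ) : 0 < (short σ k n).ncard :=
  (Set.ncard_pos (short_finite n)).2 ⟨_, nil_mem_short n⟩

lemma exists_split [Nonempty Q] (m : ℕ) (w : List C) : ∀ (n : ℕ) (q : Q), Reduced w →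
    len σ k q w ≤ n + m → ∃ u p, w = u ++ p ∧ u ∈ short σ k m ∧ p.tail ∈ short σ k n ∧
      len σ k q p.tail ≤ n := by
  induction w using List.reverseRecOn with
  | nil => exact fun n q _ _ =>
      ⟨[], [], rfl, nil_mem_short m, nil_mem_short n, Nat.zero_le _⟩
  | append_singleton w c ih =>
    intro n q hw hlen
    rw [len_append] at hlen
    by_cases hs : len σ k q [c] ≤ n
    · obtain ⟨u, p, rfl, hu, hp, hpn⟩ := ih (n - len σ k q [c]) (act σ [c] q)
        (reduced_append_left hw) (by omega)
      have hlen' : len σ k q (p ++ [c]).tail ≤ n := by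
        cases p with
        | nil => simp [len]
        | cons a p =>
          simp only [List.cons_append, List.tail_cons] at hpn ⊢
          rw [len_append]; omega
      refine ⟨u, p ++ [c], by simp, hu, ⟨?_, q, hlen'⟩, hlen'⟩
      rw [List.append_assoc] at hw
      exact (reduced_append_right hw).tail
    · exact ⟨w, [c], rfl, ⟨reduced_append_left hw, act σ [c] q, by omega⟩,
        nil_mem_short n, Nat.zero_le _⟩

lemma short_ncard_mul [Fintype C] [Nonempty Q] (m n : ℕ) :
    (short σ k (n + m)).ncard ≤
      (short σ k m).ncard * ((Fintype.card C + 1) * (short σ k n).ncard) := by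
  classical
  let F : List C × (Option C × List C) → List C := fun x => x.1 ++ (x.2.1.toList ++ x.2.2)
  have hfin : (short σ k m ×ˢ ((Set.univ : Set (Option C)) ×ˢ short σ k n)).Finite :=
    (short_finite m).prod (Set.finite_univ.prod (short_finite n))
  calc (short σ k (n + m)).ncard
      ≤ (F '' (short σ k m ×ˢ ((Set.univ : Set (Option C)) ×ˢ short σ k n))).ncard := by
        refine Set.ncard_le_ncard ?_ (hfin.image F)
        rintro w ⟨hw, q, hq⟩
        obtain ⟨u, p, rfl, hu, hp, -⟩ := exists_split m w n q hw hq
        cases p with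
        | nil => exact ⟨(u, none, []), ⟨hu, trivial, hp⟩, rfl⟩
        | cons a p => exact ⟨(u, some a, p), ⟨hu, trivial, hp⟩, rfl⟩
    _ ≤ _ := Set.ncard_image_le hfin
    _ = _ := by
        rw [Set.ncard_prod, Set.ncard_prod, Set.ncard_univ, Nat.card_eq_fintype_card,
          Fintype.card_option]

lemma exists_growth [Fintype C] [Nonempty Q] (σ : C → Q → Q) (k : Q → ℕ) :
    ∃ Λ : ℝ, Tendsto (fun n : ℕ => Real.log (short σ k n).ncard / n) atTop (𝓝 Λ) := by
  set D : ℝ := Fintype.card C + 1 with hD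
  have hD1 : 1 ≤ D := by simp [hD]
  have hpos (n : ℕ) : (1 : ℝ) ≤ (short σ k n).ncard := by exact_mod_cast short_ncard_pos n
  have hsub : Subadditive fun n => Real.log D + Real.log (short σ k n).ncard := by
    intro n m
    have h : ((short σ k (n + m)).ncard : ℝ) ≤
        (short σ k m).ncard * (D * (short σ k n).ncard) := by
      rw [hD]; exact_mod_cast short_ncard_mul m n
    have h1 := hpos m
    have h2 := hpos n
    have := Real.log_le_log (by linarith [hpos (n + m)]) h
    rw [Real.log_mul (by positivity) (by positivity),
      Real.log_mul (by positivity) (by positivity)] at this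
    linarith
  have hbdd : BddBelow (Set.range fun n : ℕ =>
      (Real.log D + Real.log (short σ k n).ncard) / n) := by
    refine ⟨0, ?_⟩
    rintro _ ⟨n, rfl⟩
    have := Real.log_nonneg hD1
    have := Real.log_nonneg (hpos n)
    positivity
  refine ⟨hsub.lim, ?_⟩
  have := (hsub.tendsto_lim hbdd).sub (tendsto_const_div_atTop_nhds_zero_nat (Real.log D))
  rw [sub_zero] at this
  refine this.congr fun n => ?_
  ring

end Words

section Growth

lemma tendsto_comp_linear {f : ℕ → ℝ} {Λ : ℝ} (hf : Tendsto (fun n : ℕ => f n / n) atTop (𝓝 Λ))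
    (a b : ℕ) (ha : 1 ≤ a) :
    Tendsto (fun m : ℕ => f (a * m + b) / m) atTop (𝓝 (a * Λ)) := by
  have h1 : Tendsto (fun m : ℕ => a * m + b) atTop atTop :=
    tendsto_atTop_mono (fun m => by simp only [id]; nlinarith) tendsto_id
  have h2 : Tendsto (fun m : ℕ => (a : ℝ) + b / m) atTop (𝓝 (a + 0)) :=
    tendsto_const_nhds.add (tendsto_const_div_atTop_nhds_zero_nat (b : ℝ))
  rw [add_zero] at h2
  refine (h2.mul (hf.comp h1)).congr' ?_
  filter_upwards [eventually_ge_atTop 1] with m hm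
  have hm' : (0 : ℝ) < m := by exact_mod_cast hm
  have ha' : (0 : ℝ) < a := by exact_mod_cast ha
  have : (0 : ℝ) < a * m + b := by positivity
  simp only [Function.comp_apply, Nat.cast_add, Nat.cast_mul]
  field_simp

lemma tendsto_of_sandwich {f g : ℕ → ℝ} {Λ D : ℝ} {K : ℕ}
    (hf : Tendsto (fun n : ℕ => f n / n) atTop (𝓝 Λ))
    (h1 : ∀ n, f n ≤ g (n + K) + D) (h2 : ∀ n, g n ≤ f (n + K) + D) :
    Tendsto (fun n : ℕ => g n / n) atTop (𝓝 Λ) := by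
  have hD := tendsto_const_div_atTop_nhds_zero_nat D
  have hu : Tendsto (fun n : ℕ => (f (n + K) + D) / n) atTop (𝓝 Λ) := by
    have := (tendsto_comp_linear hf 1 K le_rfl).add hD
    simpa [add_div] using this
  have hl : Tendsto (fun n : ℕ => (f (n - K) - D) / n) atTop (𝓝 Λ) := by
    rw [← tendsto_add_atTop_iff_nat K]
    have h3 : Tendsto (fun n : ℕ => ((n : ℝ) + K) / n) atTop (𝓝 1) := by
      have := (tendsto_const_div_atTop_nhds_zero_nat (K : ℝ)).const_add 1
      rw [add_zero] at this
      refine this.congr' ?_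
      filter_upwards [eventually_ge_atTop 1] with n hn
      have hn' : (0 : ℝ) < n := by exact_mod_cast hn
      field_simp
    have h4 := (hf.sub hD).div h3 one_ne_zero
    rw [sub_zero, div_one] at h4
    refine h4.congr' ?_
    filter_upwards [eventually_ge_atTop 1] with n hn
    have hn' : (0 : ℝ) < n := by exact_mod_cast hn
    have : (0 : ℝ) < n + K := by positivity
    simp only [Nat.add_sub_cancel, Nat.cast_add, Pi.div_apply]
    field_simp
  refine tendsto_of_tendsto_of_tendsto_of_le_of_le' hl hu ?_ ?_
  · filter_upwards [eventually_ge_atTop K] with n hn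
    have := h1 (n - K)
    rw [Nat.sub_add_cancel hn] at this
    gcongr
    linarith
  · exact Eventually.of_forall fun n => by
      have := h2 n
      gcongr

variable {C Q : Type} {σ : C → Q → Q} {k : Q → ℕ}

/-- `Λ` is the exponential growth rate of the number of reduced words by cost. -/
def HasGrowth (σ : C → Q → Q) (k : Q → ℕ) (Λ : ℝ) : Prop :=
  Tendsto (fun n : ℕ => Real.log (short σ k n).ncard / n) atTop (𝓝 Λ)

lemma log_ncard_le [Finite C] [Nonempty Q] {n : ℕ} {x : ℝ}
    (h : ((short σ k n).ncard : ℝ) ≤ x) : Real.log (short σ k n).ncard ≤ Real.log x :=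
  Real.log_le_log (by exact_mod_cast short_ncard_pos n) h

lemma HasGrowth.add_single_ge [Finite C] [Nonempty Q] [DecidableEq Q] {R : ℕ}
    (hR : GirthGT σ R) (p : Q) {Λ Λ' : ℝ} (h : HasGrowth σ k Λ)
    (h' : HasGrowth σ (k + Pi.single p 1) Λ') : (R + 1) * Λ ≤ (R + 3) * Λ' := by
  have h1 := tendsto_comp_linear h (R + 1) 0 (by omega)
  have h2 := tendsto_comp_linear h' (R + 3) 2 (by omega)
  have := le_of_tendsto_of_tendsto' h1 h2 fun m => by
    refine div_le_div_of_nonneg_right (log_ncard_le ?_) (Nat.cast_nonneg m)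
    norm_cast
    refine Set.ncard_le_ncard ?_ (short_finite _)
    rintro w ⟨hw, q, hq⟩
    refine ⟨hw, q, ?_⟩
    have e1 := (Nat.le_add_right _ _).trans (len_add_single_le (σ := σ) (k := k) p q w)
    have e2 := visits_le hR p q hw
    have e3 := length_le_len (σ := σ) (k := k) q w
    have e4 : visits σ p q w ≤ m + 1 := by
      by_contra! hv
      have : (R + 1) * (m + 2) ≤ (R + 1) * visits σ p q w := Nat.mul_le_mul_left _ hv
      nlinarith
    nlinarith
  exact_mod_cast this

lemma ncard_length_le [Fintype C] (n : ℕ) :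
    {w : List C | w.length ≤ n}.ncard ≤ (Fintype.card C + 1) ^ n := by
  induction n with
  | zero =>
    have : {w : List C | w.length ≤ 0} = {[]} := by ext w; simp
    rw [this]; simp
  | succ n ih =>
    let F : Option C × List C → List C := fun x => x.1.toList ++ x.2
    have hfin := (Set.finite_univ (α := Option C)).prod (List.finite_length_le C n)
    calc {w : List C | w.length ≤ n + 1}.ncard
        ≤ (F '' (Set.univ ×ˢ {w : List C | w.length ≤ n})).ncard := by
          refine Set.ncard_le_ncard ?_ (hfin.image F)
          intro w hw
          cases w with
          | nil => exact ⟨(none, []), ⟨trivial, Nat.zero_le _⟩, rfl⟩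
          | cons a w => exact ⟨(some a, w), ⟨trivial, by simpa using hw⟩, rfl⟩
      _ ≤ _ := Set.ncard_image_le hfin
      _ ≤ _ := by
          rw [Set.ncard_prod, Set.ncard_univ, Nat.card_eq_fintype_card, Fintype.card_option,
            pow_succ, mul_comm]
          gcongr

lemma HasGrowth.const_le [Fintype C] [Nonempty Q] {K : ℕ} {Λ : ℝ}
    (h : HasGrowth σ (fun _ => K) Λ) : (2 * K + 1) * Λ ≤ Real.log (Fintype.card C + 1) := by
  have h1 := tendsto_comp_linear h (2 * K + 1) 0 (by omega)
  have := le_of_tendsto h1 (b := Real.log (Fintype.card C + 1)) (by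
    filter_upwards [eventually_ge_atTop 1] with m hm
    have hm' : (0 : ℝ) < m := by exact_mod_cast hm
    rw [div_le_iff₀ hm', mul_comm _ (m : ℝ), ← Real.log_pow]
    refine log_ncard_le ?_
    norm_cast
    refine le_trans (Set.ncard_le_ncard ?_ (List.finite_length_le C m)) (ncard_length_le m)
    rintro w ⟨hw, q, hq⟩
    rw [len_const] at hq
    exact Nat.le_of_mul_le_mul_left hq (by omega))
  exact_mod_cast this

lemma HasGrowth.le [Fintype C] [Nonempty Q] {Λ : ℝ} (h : HasGrowth σ k Λ) :
    Λ ≤ Real.log (Fintype.card C + 1) := by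
  refine le_of_tendsto h ?_
  filter_upwards [eventually_ge_atTop 1] with m hm
  have hm' : (0 : ℝ) < m := by exact_mod_cast hm
  rw [div_le_iff₀ hm', mul_comm, ← Real.log_pow]
  refine log_ncard_le ?_
  norm_cast
  refine le_trans (Set.ncard_le_ncard ?_ (List.finite_length_le C m)) (ncard_length_le m)
  rintro w ⟨hw, q, hq⟩
  exact (length_le_len q w).trans hq

/-- An injective encoding of arbitrary words by reduced words over one more letter. -/
def encode {m : ℕ} : List (Fin m) → List (Fin (m + 1))
  | [] => []
  | i :: t => ((encode t).headD 0).succAbove i :: encode t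

lemma encode_length {m : ℕ} (w : List (Fin m)) : (encode w).length = w.length := by
  induction w with
  | nil => rfl
  | cons i t ih => simp [encode, ih]

lemma encode_reduced {m : ℕ} (w : List (Fin m)) : Reduced (encode w) := by
  induction w with
  | nil => exact reduced_nil
  | cons i t ih =>
    refine reduced_cons.2 ⟨?_, ih⟩
    cases h : encode t with
    | nil => simp
    | cons a s => simp [(Fin.succAbove_ne a i).symm]

lemma encode_injective {m : ℕ} : Function.Injective (encode (m := m)) := by
  intro w
  induction w with
  | nil =>
    intro v hv
    cases v with
    | nil => rfl
    | cons j s => simp [encode] at hv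
  | cons i t ih =>
    intro v hv
    cases v with
    | nil => simp [encode] at hv
    | cons j s =>
      simp only [encode, List.cons.injEq] at hv
      obtain rfl := ih hv.2
      rw [Fin.succAbove_right_injective hv.1]

lemma HasGrowth.zero_ge {m : ℕ} [Nonempty Q] {σ : Fin (m + 1) → Q → Q} {Λ : ℝ} (hm : 1 ≤ m)
    (h : HasGrowth σ (fun _ => 0) Λ) : Real.log m ≤ Λ := by
  refine ge_of_tendsto h ?_
  filter_upwards [eventually_ge_atTop 1] with n hn
  have hn' : (0 : ℝ) < n := by exact_mod_cast hn
  have hm' : (0 : ℝ) < m := by exact_mod_cast hm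
  rw [le_div_iff₀ hn', mul_comm, ← Real.log_pow]
  refine Real.log_le_log (by positivity) ?_
  norm_cast
  calc m ^ n = Nat.card (List.Vector (Fin m) n) := by simp
    _ = {w : List (Fin m) | w.length = n}.ncard := by
        rw [← Nat.card_coe_set_eq]; rfl
    _ ≤ _ := Set.ncard_le_ncard_of_injOn (t := short σ (fun _ => 0) n) encode (fun w hw =>
        ⟨encode_reduced w, Classical.arbitrary Q, by
          rw [len_const, encode_length, show w.length = n from hw]; simp⟩)
        encode_injective.injOn (short_finite n)

lemma exists_growth_near [Fintype C] [Finite Q] [Nonempty Q] {R K : ℕ}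
    (hR : GirthGT σ R) {β Λ₀ : ℝ} (h₀ : HasGrowth σ (fun _ => 0) Λ₀) (hβ : β ≤ Λ₀)
    (hK : ∀ Λ, HasGrowth σ (fun _ => K) Λ → Λ < β) :
    ∃ k Λ, HasGrowth σ k Λ ∧ β ≤ Λ ∧
      Λ ≤ β + 2 * Real.log (Fintype.card C + 1) / (R + 1) := by
  classical
  have := Fintype.ofFinite Q
  by_contra! hcon
  suffices H : ∀ (n : ℕ) (k : Q → ℕ), ∑ q, k q = n → ∀ Λ, HasGrowth σ k Λ → β ≤ Λ by
    obtain ⟨Λ, hΛ⟩ := exists_growth σ (fun _ : Q => K)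
    exact absurd (H _ _ rfl Λ hΛ) (not_le.2 (hK Λ hΛ))
  intro n
  induction n with
  | zero =>
    intro k hk Λ hΛ
    have : k = fun _ => 0 := by
      funext q
      simpa using (Finset.sum_eq_zero_iff.1 hk) q (Finset.mem_univ q)
    subst this
    rwa [tendsto_nhds_unique hΛ h₀]
  | succ n ih =>
    intro k hk Λ' hΛ'
    obtain ⟨p, -, hp⟩ : ∃ p ∈ Finset.univ, k p ≠ 0 :=
      Finset.exists_ne_zero_of_sum_ne_zero (by omega)
    obtain ⟨k, rfl⟩ : ∃ k' : Q → ℕ, k = k' + Pi.single p 1 := by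
      refine ⟨k - Pi.single p 1, ?_⟩
      funext q
      by_cases hq : q = p
      · subst hq; simp; omega
      · simp [hq]
    have hk' : ∑ q, k q = n := by
      simp [Finset.sum_add_distrib, Pi.single_apply] at hk
      exact hk
    obtain ⟨Λ, hΛ⟩ := exists_growth σ k
    have h1 := ih k hk' Λ hΛ
    have h2 := hcon k Λ hΛ h1
    have h3 := HasGrowth.add_single_ge hR p hΛ hΛ'
    have h4 := HasGrowth.le hΛ'
    have hR' : (0 : ℝ) < R + 1 := by positivity
    have h5 : (R + 1) * (2 * Real.log (Fintype.card C + 1) / (R + 1))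
      = 2 * Real.log (Fintype.card C + 1) := by field_simp
    nlinarith

end Growth

section FiniteQuotient

variable {C : Type}

/-- Reduced words of length at most `R`. -/
abbrev WordBall (C : Type) (R : ℕ) : Type := {w : List C // Reduced w ∧ w.length ≤ R}

variable [DecidableEq C]

/-- The involution `c` on the ball of reduced words, fixing the words it would move outside. -/
def ballToggle (R : ℕ) (c : C) (w : WordBall C R) : WordBall C R :=
  if h : (toggle c w.1).length ≤ R then ⟨toggle c w.1, toggle_reduced c w.2.1, h⟩ else w

lemma ballToggle_involutive (R : ℕ) (c : C) : Function.Involutive (ballToggle (C := C) R c) := by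
  intro w
  by_cases h : (toggle c w.1).length ≤ R
  · have h1 : ballToggle R c w = ⟨toggle c w.1, toggle_reduced c w.2.1, h⟩ := dif_pos h
    have h2 : toggle c (toggle c w.1) = w.1 := toggle_toggle c w.2.1
    rw [h1]
    apply Subtype.ext
    rw [ballToggle, dif_pos (by rw [h2]; exact w.2.2)]
    exact h2
  · have h1 : ballToggle R c w = w := dif_neg h
    rw [h1, h1]

lemma act_ballToggle_nil (R : ℕ) (w : List C) (hw : Reduced w) (h : w.length ≤ R) :
    act (ballToggle R) w ⟨[], reduced_nil, Nat.zero_le _⟩ = ⟨w, hw, h⟩ := by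
  induction w with
  | nil => rfl
  | cons c w ih =>
    have hc := reduced_cons.1 hw
    have h' : w.length ≤ R := by simp at h; omega
    have ht := toggle_of_ne hc.1
    rw [act_cons, ih hc.2 h', ballToggle, dif_pos (by rw [ht]; exact h)]
    exact Subtype.ext ht

/-- Left composition with the ball involutions, as an action on permutations of the ball. -/
def permAct (R : ℕ) (c : C) (q : Equiv.Perm (WordBall C R)) : Equiv.Perm (WordBall C R) :=
  (ballToggle_involutive R c).toPerm * q

lemma act_permAct_apply (R : ℕ) (w : List C) (q : Equiv.Perm (WordBall C R)) (x : WordBall C R) :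
    act (permAct R) w q x = act (ballToggle R) w (q x) := by
  induction w with
  | nil => rfl
  | cons c w ih => simp [permAct, ih]

lemma girthGT_permAct (R : ℕ) : GirthGT (permAct (C := C) R) R := by
  intro w hw hne hlen q hq
  have h := act_permAct_apply R w q (q.symm ⟨[], reduced_nil, Nat.zero_le _⟩)
  rw [hq, Equiv.apply_symm_apply, act_ballToggle_nil R w hw hlen] at h
  exact hne (congrArg Subtype.val h).symm

lemma exists_finite_action (C : Type) [DecidableEq C] [Finite C] (R : ℕ) :
    ∃ (Q : Type) (σ : C → Q → Q) (o : Q), Finite Q ∧ (∀ c q, σ c (σ c q) = q) ∧ GirthGT σ R ∧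
      ∀ q, ∃ w, Reduced w ∧ act σ w o = q := by
  have hσ (c : C) (q) : permAct R c (permAct R c q) = q := by
    ext1 x
    simp [permAct, ballToggle_involutive R c (q x)]
  have : Finite (WordBall C R) :=
    ((List.finite_length_le C R).subset fun w (hw : Reduced w ∧ w.length ≤ R) => hw.2).to_subtype
  let Q := {q : Equiv.Perm (WordBall C R) // ∃ w, Reduced w ∧ act (permAct R) w 1 = q}
  let τ : C → Q → Q := fun c q => ⟨permAct R c q.1, by
    obtain ⟨w, hw, h⟩ := q.2
    exact ⟨toggle c w, toggle_reduced c hw, by rw [act_toggle hσ, h]⟩⟩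
  have hact (w : List C) (q : Q) : (act τ w q).1 = act (permAct R) w q.1 := by
    induction w with
    | nil => rfl
    | cons c w ih => simp only [act_cons, ← ih]; rfl
  refine ⟨Q, τ, ⟨1, [], reduced_nil, rfl⟩, inferInstance, fun c q => Subtype.ext (hσ c q.1),
    fun w hw hne hlen q hq => girthGT_permAct R w hw hne hlen q.1 ?_, fun q => ?_⟩
  · rw [← hact, hq]
  · obtain ⟨w, hw, h⟩ := q.2
    exact ⟨w, hw, Subtype.ext (by rw [hact]; exact h)⟩

end FiniteQuotient

section Reach

variable {C Q : Type} {σ : C → Q → Q}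

/-- The word `(y x)^n` followed by `p`. -/
def alternate (x y : C) (p : List C) : ℕ → List C
  | 0 => p
  | n + 1 => y :: x :: alternate x y p n

lemma act_alternate (x y : C) (p : List C) (o : Q) (n : ℕ) :
    act σ (alternate x y p n) o = (fun q => σ y (σ x q))^[n] (act σ p o) := by
  induction n with
  | zero => rfl
  | succ n ih => rw [Function.iterate_succ_apply', ← ih]; rfl

lemma alternate_reduced {x y : C} (hxy : x ≠ y) {p : List C} (hp : Reduced p)
    (hx : p.head? ≠ some x) (n : ℕ) : Reduced (alternate x y p n) := by
  induction n with
  | zero => exact hp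
  | succ n ih =>
    refine reduced_cons.2 ⟨by simpa using hxy, reduced_cons.2 ⟨?_, ih⟩⟩
    cases n with
    | zero => exact hx
    | succ n => simpa [alternate] using hxy.symm

lemma exists_reach_avoiding [Finite Q] (hC : ∀ a b : C, ∃ c, c ≠ a ∧ c ≠ b)
    (hσ : ∀ c q, σ c (σ c q) = q) {o : Q} (ho : ∀ q, ∃ w, Reduced w ∧ act σ w o = q)
    (q : Q) (c : C) : ∃ p, Reduced p ∧ act σ p o = q ∧ p.head? ≠ some c := by
  obtain ⟨p, hp, rfl⟩ := ho q
  by_cases hc : p.head? = some c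
  · obtain ⟨x, hx, -⟩ := hC c c
    obtain ⟨y, hy, hyx⟩ := hC c x
    have hinj : Function.Injective fun q => σ y (σ x q) := fun a b h => by
      simpa [hσ] using congrArg (fun q => σ x (σ y q)) h
    obtain ⟨n, hn, hper⟩ := hinj.mem_periodicPts (act σ p o)
    refine ⟨alternate x y p n, alternate_reduced hyx.symm hp ?_ n, ?_, ?_⟩
    · rw [hc]; simpa using hx.symm
    · rw [act_alternate]; exact hper
    · obtain ⟨n, rfl⟩ : ∃ j, n = j + 1 := ⟨n - 1, by omega⟩
      simpa [alternate] using hy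
  · exact ⟨p, hp, rfl, hc⟩

end Reach

section DepthTree

variable {V : Type} {G : SimpleGraph V} {depth : V → ℕ} {o : V}

/-- Every vertex other than `o` has exactly one neighbor of smaller depth, and depths of
adjacent vertices differ by one. -/
structure IsDepth (G : SimpleGraph V) (depth : V → ℕ) (o : V) : Prop where
  root : depth o = 0
  adj : ∀ u v, G.Adj u v → depth u = depth v + 1 ∨ depth v = depth u + 1
  exists_lower : ∀ v, v ≠ o → ∃ u, G.Adj v u ∧ depth v = depth u + 1
  lower_unique : ∀ v u u', G.Adj v u → G.Adj v u' → depth v = depth u + 1 →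
    depth v = depth u' + 1 → u = u'

lemma IsDepth.exists_walk (h : IsDepth G depth o) :
    ∀ (n : ℕ) (v : V), depth v = n → ∃ p : G.Walk o v, p.length = n := by
  intro n
  induction n with
  | zero =>
    intro v hv
    by_cases hvo : v = o
    · subst hvo; exact ⟨.nil, rfl⟩
    · obtain ⟨u, -, hu⟩ := h.exists_lower v hvo
      omega
  | succ n ih =>
    intro v hv
    have hvo : v ≠ o := fun e => by rw [e, h.root] at hv; omega
    obtain ⟨u, hadj, hu⟩ := h.exists_lower v hvo
    obtain ⟨p, hp⟩ := ih u (by omega)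
    exact ⟨p.concat hadj.symm, by simp [hp]⟩

lemma IsDepth.le_length (h : IsDepth G depth o) {u v : V} (p : G.Walk u v) :
    depth v ≤ depth u + p.length := by
  induction p with
  | nil => simp
  | cons hadj p ih =>
    have := h.adj _ _ hadj
    simp only [SimpleGraph.Walk.length_cons]
    omega

lemma IsDepth.connected (h : IsDepth G depth o) : G.Connected :=
  SimpleGraph.connected_iff_exists_forall_reachable G |>.2
    ⟨o, fun v => (h.exists_walk _ v rfl).elim fun p _ => ⟨p⟩⟩

lemma IsDepth.dist_eq (h : IsDepth G depth o) (v : V) : G.dist o v = depth v := by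
  apply le_antisymm
  · obtain ⟨p, hp⟩ := h.exists_walk _ v rfl
    rw [← hp]
    exact SimpleGraph.dist_le p
  · obtain ⟨p, hp⟩ := h.connected.exists_walk_length_eq_dist o v
    rw [← hp]
    simpa [h.root] using h.le_length p

lemma IsDepth.isTree (h : IsDepth G depth o) : G.IsTree := by
  classical
  refine ⟨h.connected, fun v c hc => ?_⟩
  obtain ⟨x, hx, hmax⟩ := c.support.toFinset.exists_max_image depth ⟨v, by simp⟩
  rw [List.mem_toFinset] at hx
  have hc' := hc.rotate hx
  set c' := c.rotate x hx
  have hmem (y : V) (hy : y ∈ c'.support) : depth y ≤ depth x := by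
    refine hmax y ?_
    rw [List.mem_toFinset]
    exact (c.mem_support_rotate_iff x hx).1 hy
  have h1 := c'.adj_snd hc'.not_nil
  have h2 := (c'.adj_penultimate hc'.not_nil).symm
  have d1 := hmem _ (c'.getVert_mem_support 1)
  have d2 := hmem _ (c'.getVert_mem_support (c'.length - 1))
  refine hc'.snd_ne_penultimate (h.lower_unique x _ _ h1 h2 ?_ ?_)
  · exact (h.adj _ _ h1).resolve_right (by simp only [SimpleGraph.Walk.snd] at *; omega)
  · exact (h.adj _ _ h2).resolve_right (by simp only [SimpleGraph.Walk.penultimate] at *; omega)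

end DepthTree

section StarGraph

variable {C H Q : Type}

/-- The position at distance `j` from the center along the arm `c` at `x`. -/
def pos (x : H) (c : C) (j : ℕ) : H × Option (C × ℕ) :=
  (x, if j = 0 then none else some (c, j))

/-- The position following `pos x c j` when moving away from the center `x`. -/
def out (τ : C → H → H) (κ : H → ℕ) (x : H) (c : C) (j : ℕ) : H × Option (C × ℕ) :=
  if j < κ x then pos x c (j + 1) else pos (τ c x) c (κ (τ c x))

/-- The vertices of the star graph: a center for each `x`, with arms of length `κ x`. -/
def Vert (C : Type) {H : Type} (κ : H → ℕ) : Type :=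
  {p : H × Option (C × ℕ) // ∀ a ∈ p.2, 1 ≤ a.2 ∧ a.2 ≤ κ p.1}

variable {τ : C → H → H} {κ : H → ℕ}

lemma pos_valid (x : H) (c : C) {j : ℕ} (hj : j ≤ κ x) :
    ∀ a ∈ (pos x c j).2, 1 ≤ a.2 ∧ a.2 ≤ κ (pos x c j).1 := by
  intro a ha
  unfold pos at ha ⊢
  split_ifs at ha with h
  · simp at ha
  · simp only [Option.mem_def, Option.some.injEq] at ha
    subst ha
    exact ⟨by simp only; omega, hj⟩

lemma out_valid (x : H) (c : C) (j : ℕ) :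
    ∀ a ∈ (out τ κ x c j).2, 1 ≤ a.2 ∧ a.2 ≤ κ (out τ κ x c j).1 := by
  unfold out
  split_ifs with h
  · exact pos_valid x c h
  · exact pos_valid _ c le_rfl

/-- The vertex at `pos x c j`. -/
def posV (κ : H → ℕ) (x : H) (c : C) (j : ℕ) (hj : j ≤ κ x) : Vert C κ :=
  ⟨pos x c j, pos_valid x c hj⟩

/-- The vertex at `out τ κ x c j`. -/
def outV (τ : C → H → H) (κ : H → ℕ) (x : H) (c : C) (j : ℕ) : Vert C κ :=
  ⟨out τ κ x c j, out_valid x c j⟩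

/-- The center of the star at `x`. -/
def center (C : Type) (κ : H → ℕ) (x : H) : Vert C κ := ⟨(x, none), by simp⟩

lemma Vert.cases_center_or_arm (v : Vert C κ) :
    (∃ x, v = center C κ x) ∨ ∃ x c j, ∃ hj : j ≤ κ x, 1 ≤ j ∧ v = posV κ x c j hj := by
  obtain ⟨⟨x, _ | ⟨c, j⟩⟩, hv⟩ := v
  · exact .inl ⟨x, rfl⟩
  · obtain ⟨h1, h2⟩ := hv (c, j) rfl
    refine .inr ⟨x, c, j, h2, h1, Subtype.ext ?_⟩
    simp only [posV, pos]
    rw [if_neg (by simp only at h1; omega)]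

lemma posV_zero (x : H) (c : C) : posV κ x c 0 (Nat.zero_le _) = center C κ x := rfl

lemma pos_eq_none {x y : H} {c : C} {j : ℕ} (h : pos y c j = (x, none)) : y = x ∧ j = 0 := by
  unfold pos at h
  split_ifs at h with hj
  · exact ⟨congrArg Prod.fst h, hj⟩
  · simp at h

lemma pos_eq_pos {x y : H} {c d : C} {i j : ℕ} (hj : 1 ≤ j) (h : pos y d i = pos x c j) :
    y = x ∧ d = c ∧ i = j := by
  unfold pos at h
  rw [if_neg (show j ≠ 0 by omega)] at h
  split_ifs at h with hi
  · simp at h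
  · simpa using h

lemma out_ne_pos (hne : ∀ c x, τ c x ≠ x) (x : H) (c d : C) {i j : ℕ} (hij : i ≤ j) :
    out τ κ x c j ≠ pos x d i := by
  unfold out
  split_ifs with h
  · intro e
    have := pos_eq_pos (by omega) e.symm
    omega
  · exact fun e => hne c x (congrArg Prod.fst e)

lemma pos_succ_ne_pos (x : H) (c : C) (j : ℕ) : pos x c (j + 1) ≠ pos x c j := by
  intro e
  have := pos_eq_pos (by omega) e.symm
  omega

lemma out_zero_injective (hinj : ∀ x c d, τ c x = τ d x → c = d)
    (x : H) {c d : C} (h : out τ κ x c 0 = out τ κ x d 0) : c = d := by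
  unfold out at h
  split_ifs at h with hx
  · exact (pos_eq_pos (by omega) h).2.1
  · exact hinj x c d (congrArg Prod.fst h)

/-- One position follows or precedes the other along an arm. -/
def NextTo (τ : C → H → H) (κ : H → ℕ) (u v : H × Option (C × ℕ)) : Prop :=
  ∃ x c j, j ≤ κ x ∧ u = pos x c j ∧ (v = out τ κ x c j ∨ 1 ≤ j ∧ v = pos x c (j - 1))

lemma NextTo.symm (hτ : ∀ c x, τ c (τ c x) = x) {u v : H × Option (C × ℕ)}
    (h : NextTo τ κ u v) : NextTo τ κ v u := by
  obtain ⟨x, c, j, hj, rfl, rfl | ⟨h1, rfl⟩⟩ := h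
  · by_cases hlt : j < κ x
    · exact ⟨x, c, j + 1, hlt, by simp [out, hlt], .inr ⟨by omega, rfl⟩⟩
    · refine ⟨τ c x, c, κ (τ c x), le_rfl, by simp [out, hlt], .inl ?_⟩
      have : j = κ x := by omega
      simp [out, hτ, this]
  · refine ⟨x, c, j - 1, by omega, rfl, .inl ?_⟩
    rw [out, if_pos (by omega), Nat.sub_add_cancel h1]

/-- The graph with a star of arms at each `x`, where the tip of the arm `c` at `x` is joined to the
tip of the arm `c` at `τ c x`. -/
def starGraph (τ : C → H → H) (κ : H → ℕ) (hτ : ∀ c x, τ c (τ c x) = x)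
    (hne : ∀ c x, τ c x ≠ x) : SimpleGraph (Vert C κ) where
  Adj u v := NextTo τ κ u.1 v.1
  symm := ⟨fun _ _ h => h.symm hτ⟩
  loopless := ⟨by
    rintro ⟨u, hu⟩ ⟨x, c, j, hj, h, h' | ⟨h1, h'⟩⟩
    · exact out_ne_pos hne x c c le_rfl (h'.symm.trans h)
    · obtain ⟨j, rfl⟩ : ∃ i, j = i + 1 := ⟨j - 1, by omega⟩
      exact pos_succ_ne_pos x c j (h.symm.trans h')⟩

variable {hτ : ∀ c x, τ c (τ c x) = x} {hne : ∀ c x, τ c x ≠ x}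

lemma adj_center {x : H} {v : Vert C κ} :
    (starGraph τ κ hτ hne).Adj (center C κ x) v ↔ ∃ c, v = outV τ κ x c 0 := by
  constructor
  · rintro ⟨y, c, j, -, h, h'⟩
    obtain ⟨rfl, rfl⟩ := pos_eq_none h.symm
    rcases h' with h' | ⟨h1, -⟩
    · exact ⟨c, Subtype.ext h'⟩
    · omega
  · rintro ⟨c, rfl⟩
    exact ⟨x, c, 0, Nat.zero_le _, rfl, .inl rfl⟩

lemma adj_arm {x : H} {c : C} {j : ℕ} {hj : j ≤ κ x} (h1 : 1 ≤ j) {v : Vert C κ} :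
    (starGraph τ κ hτ hne).Adj (posV κ x c j hj) v ↔
      v = outV τ κ x c j ∨ v = posV κ x c (j - 1) (by omega) := by
  constructor
  · rintro ⟨y, d, i, -, h, h'⟩
    obtain ⟨rfl, rfl, rfl⟩ := pos_eq_pos h1 h.symm
    rcases h' with h' | ⟨-, h'⟩
    · exact .inl (Subtype.ext h')
    · exact .inr (Subtype.ext h')
  · rintro (rfl | rfl)
    · exact ⟨x, c, j, hj, rfl, .inl rfl⟩
    · exact ⟨x, c, j, hj, rfl, .inr ⟨h1, rfl⟩⟩

lemma neighborSet_center_ncard [Fintype C] (hinj : ∀ x c d, τ c x = τ d x → c = d) (x : H) :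
    ((starGraph τ κ hτ hne).neighborSet (center C κ x)).ncard = Fintype.card C := by
  have : (starGraph τ κ hτ hne).neighborSet (center C κ x)
      = (fun c => outV τ κ x c 0) '' Set.univ := by
    ext v
    simp only [SimpleGraph.mem_neighborSet, adj_center, Set.mem_image, Set.mem_univ, true_and,
      eq_comm]
  rw [this, Set.ncard_image_of_injective, Set.ncard_univ, Nat.card_eq_fintype_card]
  exact fun c d h => out_zero_injective hinj x (congrArg Subtype.val h)

lemma neighborSet_arm_ncard {x : H} {c : C} {j : ℕ} {hj : j ≤ κ x} (h1 : 1 ≤ j) :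
    ((starGraph τ κ hτ hne).neighborSet (posV κ x c j hj)).ncard = 2 := by
  have : (starGraph τ κ hτ hne).neighborSet (posV κ x c j hj)
      = {outV τ κ x c j, posV κ x c (j - 1) (by omega)} := by
    ext v
    simp [adj_arm h1]
  rw [this, Set.ncard_pair]
  exact fun h => out_ne_pos hne x c c (Nat.sub_le j 1) (congrArg Subtype.val h)

lemma two_le_ncard_neighborSet [Fintype C] (hinj : ∀ x c d, τ c x = τ d x → c = d)
    (hC : 2 ≤ Fintype.card C) (v : Vert C κ) :
    2 ≤ ((starGraph τ κ hτ hne).neighborSet v).ncard ∧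
      ((starGraph τ κ hτ hne).neighborSet v).ncard ≤ Fintype.card C := by
  rcases v.cases_center_or_arm with ⟨x, rfl⟩ | ⟨x, c, j, hj, h1, rfl⟩
  · rw [neighborSet_center_ncard hinj]; exact ⟨hC, le_rfl⟩
  · rw [neighborSet_arm_ncard h1]; exact ⟨le_rfl, hC⟩

instance [Finite C] [Finite H] : Finite (Vert C κ) := by
  have : Fintype H := Fintype.ofFinite H
  let N := ∑ x, κ x
  have hfin : ((Set.univ : Set H) ×ˢ
      (insert none (some '' ((Set.univ : Set C) ×ˢ Set.Iic N)))).Finite :=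
    Set.finite_univ.prod (((Set.finite_univ.prod (Set.finite_Iic N)).image some).insert none)
  suffices hsub : {p : H × Option (C × ℕ) | ∀ a ∈ p.2, 1 ≤ a.2 ∧ a.2 ≤ κ p.1} ⊆
      Set.univ ×ˢ insert none (some '' ((Set.univ : Set C) ×ˢ Set.Iic N)) from
    (hfin.subset hsub).to_subtype
  rintro ⟨x, _ | ⟨c, j⟩⟩ hp
  · exact ⟨trivial, .inl rfl⟩
  · refine ⟨trivial, .inr ⟨(c, j), ⟨trivial, ?_⟩, rfl⟩⟩
    exact (hp (c, j) rfl).2.trans (Finset.single_le_sum (f := κ) (fun _ _ => Nat.zero_le _)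
      (Finset.mem_univ x))

section Covering

variable {σ : C → Q → Q} {k : Q → ℕ} (φ : H → Q)

/-- The map of star graphs induced by a map of actions. -/
def starMap (k : Q → ℕ) (v : Vert C (fun x => k (φ x))) : Vert C k :=
  ⟨(φ v.1.1, v.1.2), v.2⟩

variable {φ}

lemma starMap_posV (x : H) (c : C) (j : ℕ) (hj : j ≤ k (φ x)) :
    starMap φ k (posV (fun x => k (φ x)) x c j hj) = posV k (φ x) c j hj := rfl

lemma starMap_center (x : H) :
    starMap φ k (center C (fun x => k (φ x)) x) = center C k (φ x) := rfl

lemma starMap_outV (hφ : ∀ c x, φ (τ c x) = σ c (φ x)) (x : H) (c : C) (j : ℕ) :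
    starMap φ k (outV τ (fun x => k (φ x)) x c j) = outV σ k (φ x) c j := by
  apply Subtype.ext
  simp only [starMap, outV, out]
  by_cases h : j < k (φ x)
  · simp only [h, if_true]; rfl
  · simp only [h, if_false, pos, hφ]

lemma starMap_surjective (hs : Function.Surjective φ) :
    Function.Surjective (starMap (C := C) φ k) := by
  rintro ⟨⟨q, a⟩, hv⟩
  obtain ⟨x, rfl⟩ := hs q
  exact ⟨⟨(x, a), hv⟩, rfl⟩

lemma isGraphCovering_starMap (hφ : ∀ c x, φ (τ c x) = σ c (φ x))
    (hσ : ∀ c q, σ c (σ c q) = q) (hne' : ∀ c q, σ c q ≠ q)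
    (hinj : ∀ q c d, σ c q = σ d q → c = d) :
    IsGraphCovering (starGraph τ (fun x => k (φ x)) hτ hne) (starGraph σ k hσ hne')
      (starMap φ k) := by
  have hom : ∀ u v, (starGraph τ (fun x => k (φ x)) hτ hne).Adj u v →
      (starGraph σ k hσ hne').Adj (starMap φ k u) (starMap φ k v) := by
    intro u v h
    rcases u.cases_center_or_arm with ⟨x, rfl⟩ | ⟨x, c, j, hj, h1, rfl⟩
    · obtain ⟨c, rfl⟩ := adj_center.1 h
      exact adj_center.2 ⟨c, starMap_outV hφ x c 0⟩
    · rw [starMap_posV]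
      refine (adj_arm h1).2 ?_
      rcases (adj_arm h1).1 h with rfl | rfl
      · exact .inl (starMap_outV hφ x c j)
      · exact .inr rfl
  refine ⟨hom, fun v => ⟨fun u hu => hom v u hu, ?_, ?_⟩⟩
  · intro u hu u' hu' he
    rw [SimpleGraph.mem_neighborSet] at hu hu'
    rcases v.cases_center_or_arm with ⟨x, rfl⟩ | ⟨x, c, j, hj, h1, rfl⟩
    · obtain ⟨c, rfl⟩ := adj_center.1 hu
      obtain ⟨d, rfl⟩ := adj_center.1 hu'
      rw [starMap_outV hφ, starMap_outV hφ] at he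
      rw [out_zero_injective hinj (φ x) (congrArg Subtype.val he)]
    · have key : outV σ k (φ x) c j ≠ posV k (φ x) c (j - 1) (by omega) :=
        fun e => out_ne_pos hne' (φ x) c c (Nat.sub_le j 1) (congrArg Subtype.val e)
      rcases (adj_arm h1).1 hu with rfl | rfl <;> rcases (adj_arm h1).1 hu' with rfl | rfl
      · rfl
      · rw [starMap_outV hφ, starMap_posV] at he
        exact absurd he key
      · rw [starMap_outV hφ, starMap_posV] at he
        exact absurd he.symm key
      · rfl
  · intro y hy
    rw [SimpleGraph.mem_neighborSet] at hy
    rcases v.cases_center_or_arm with ⟨x, rfl⟩ | ⟨x, c, j, hj, h1, rfl⟩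
    · rw [starMap_center] at hy
      obtain ⟨c, rfl⟩ := adj_center.1 hy
      exact ⟨_, (adj_center (hτ := hτ) (hne := hne)).2 ⟨c, rfl⟩, starMap_outV hφ x c 0⟩
    · rw [starMap_posV] at hy
      rcases (adj_arm h1).1 hy with rfl | rfl
      · exact ⟨_, (adj_arm (hτ := hτ) (hne := hne) h1).2 (.inl rfl), starMap_outV hφ x c j⟩
      · exact ⟨_, (adj_arm (hτ := hτ) (hne := hne) h1).2 (.inr rfl), rfl⟩

end Covering

end StarGraph

section UniversalCover

variable {C Q : Type} {σ : C → Q → Q} {k : Q → ℕ} {o : Q}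

lemma GirthGT.ne {R : ℕ} (hR : GirthGT σ R) (h : 1 ≤ R) (c : C) (q : Q) : σ c q ≠ q :=
  hR [c] (reduced_singleton c) (by simp) (by simpa using h) q

lemma GirthGT.injective {R : ℕ} (hR : GirthGT σ R) (h : 2 ≤ R)
    (hσ : ∀ c q, σ c (σ c q) = q) (q : Q) (c d : C) (hcd : σ c q = σ d q) : c = d := by
  by_contra hne
  refine hR [c, d] (reduced_cons.2 ⟨?_, reduced_singleton d⟩) (by simp) (by simpa using h) q ?_
  · simpa [eq_comm] using hne
  · simp [← hcd, hσ]

/-- The reduced words. -/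
abbrev Word (C : Type) : Type := {w : List C // Reduced w}

/-- Left multiplication by the involution `c`. -/
def move [DecidableEq C] (c : C) (w : Word C) : Word C := ⟨toggle c w.1, toggle_reduced c w.2⟩

lemma move_move [DecidableEq C] (c : C) (w : Word C) : move c (move c w) = w :=
  Subtype.ext (toggle_toggle c w.2)

/-- The endpoint of the path spelled by a reduced word from `o`. -/
def endpoint (σ : C → Q → Q) (o : Q) (w : Word C) : Q := act σ w.1 o

lemma endpoint_move [DecidableEq C] (hσ : ∀ c q, σ c (σ c q) = q) (c : C) (w : Word C) :
    endpoint σ o (move c w) = σ c (endpoint σ o w) := act_toggle hσ c w.1 o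

/-- The vertices of the universal cover. -/
abbrev CoverVert (σ : C → Q → Q) (k : Q → ℕ) (o : Q) : Type :=
  Vert C (fun w : Word C => k (endpoint σ o w))

lemma lt_len_of_head? {x : Word C} {c : C} (h : x.1.head? = some c) :
    k (endpoint σ o x) < len σ k o x.1 := by
  obtain ⟨⟨⟩ | ⟨a, t⟩, hx⟩ := x
  · simp at h
  · obtain rfl : a = c := by simpa using h
    simp only [endpoint, len, act_cons]
    omega

lemma exists_of_adj {H : Type} {τ : C → H → H} {κ : H → ℕ} {hτ : ∀ c x, τ c (τ c x) = x}
    {hne : ∀ c x, τ c x ≠ x} {u v : Vert C κ} (h : (starGraph τ κ hτ hne).Adj u v) :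
    ∃ x c j, ∃ hj : j ≤ κ x, (u = posV κ x c j hj ∧ v = outV τ κ x c j) ∨
      (v = posV κ x c j hj ∧ u = outV τ κ x c j) := by
  obtain ⟨x, c, j, hj, hu, hv | ⟨h1, hv⟩⟩ := h
  · exact ⟨x, c, j, hj, .inl ⟨Subtype.ext hu, Subtype.ext hv⟩⟩
  · refine ⟨x, c, j - 1, by omega, .inr ⟨Subtype.ext hv, Subtype.ext ?_⟩⟩
    show u.1 = out τ κ x c (j - 1)
    rw [hu, out, if_pos (by omega), Nat.sub_add_cancel h1]

variable [DecidableEq C]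

/-- The distance from the root in the universal cover. -/
def depth (v : CoverVert σ k o) : ℕ :=
  match v.1.2 with
  | none => len σ k o v.1.1.1
  | some (c, j) =>
    if v.1.1.1.head? = some c then len σ k o v.1.1.1 - j else len σ k o v.1.1.1 + j

lemma depth_center (x : Word C) :
    depth (center C (fun w : Word C => k (endpoint σ o w)) x) = len σ k o x.1 := rfl

lemma depth_posV (x : Word C) (c : C) (j : ℕ) (hj : j ≤ k (endpoint σ o x)) :
    depth (posV (fun w : Word C => k (endpoint σ o w)) x c j hj) =
      if x.1.head? = some c then len σ k o x.1 - j else len σ k o x.1 + j := by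
  rcases Nat.eq_zero_or_pos j with rfl | h
  · rw [posV_zero, depth_center]; simp
  · simp only [depth, posV, pos, if_neg h.ne']

lemma outV_of_lt {x : Word C} {c : C} {j : ℕ} (hj : j < k (endpoint σ o x)) :
    outV move (fun w : Word C => k (endpoint σ o w)) x c j = posV _ x c (j + 1) hj :=
  Subtype.ext (if_pos hj)

lemma outV_tip (x : Word C) (c : C) :
    outV move (fun w : Word C => k (endpoint σ o w)) x c (k (endpoint σ o x)) =
      posV _ (move c x) c (k (endpoint σ o (move c x))) le_rfl :=
  Subtype.ext (if_neg (lt_irrefl _))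

lemma depth_outV_of_ne (hσ : ∀ c q, σ c (σ c q) = q) {x : Word C} {c : C}
    (h : x.1.head? ≠ some c) {j : ℕ} (hj : j ≤ k (endpoint σ o x)) :
    depth (outV move (fun w : Word C => k (endpoint σ o w)) x c j) =
      depth (posV (fun w : Word C => k (endpoint σ o w)) x c j hj) + 1 := by
  rcases hj.lt_or_eq with hlt | rfl
  · rw [outV_of_lt hlt, depth_posV, depth_posV, if_neg h, if_neg h]; rfl
  · have h1 : (move c x).1 = c :: x.1 := toggle_of_ne h
    rw [outV_tip, depth_posV, depth_posV, if_neg h, h1,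
      if_pos (show (c :: x.1).head? = some c from rfl), endpoint_move hσ]
    simp only [len, endpoint]
    omega

lemma depth_outV_of_eq {x : Word C} {c : C}
    (h : x.1.head? = some c) {j : ℕ} (hj : j ≤ k (endpoint σ o x)) :
    depth (posV (fun w : Word C => k (endpoint σ o w)) x c j hj) =
      depth (outV move (fun w : Word C => k (endpoint σ o w)) x c j) + 1 := by
  have hlen := lt_len_of_head? (σ := σ) (k := k) (o := o) h
  rcases hj.lt_or_eq with hlt | rfl
  · rw [outV_of_lt hlt, depth_posV, depth_posV, if_pos h, if_pos h]; omega
  · obtain ⟨t, ht⟩ := exists_cons_of_head? h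
    have h1 : (move c x).1 = t := by simp only [move, ht, toggle_cons_self]
    have h2 : t.head? ≠ some c := (reduced_cons.1 (ht ▸ x.2)).1
    rw [outV_tip, depth_posV, depth_posV, if_pos h, h1, if_neg h2]
    simp only [endpoint, h1, ht, len, act_cons]
    omega

lemma isDepth_depth (hσ : ∀ c q, σ c (σ c q) = q) (hne : ∀ (c : C) (x : Word C), move c x ≠ x) :
    IsDepth (starGraph move (fun w : Word C => k (endpoint σ o w)) move_move hne) depth
      (center C _ ⟨[], reduced_nil⟩) where
  root := rfl
  adj u v h := by
    obtain ⟨x, c, j, hj, h⟩ := exists_of_adj h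
    by_cases hc : x.1.head? = some c
    · have := depth_outV_of_eq hc hj
      rcases h with ⟨rfl, rfl⟩ | ⟨rfl, rfl⟩ <;> simp [this]
    · have := depth_outV_of_ne hσ hc hj
      rcases h with ⟨rfl, rfl⟩ | ⟨rfl, rfl⟩ <;> simp [this]
  exists_lower v hv := by
    rcases v.cases_center_or_arm with ⟨x, rfl⟩ | ⟨x, c, j, hj, h1, rfl⟩
    · obtain ⟨⟨⟩ | ⟨c, t⟩, hx⟩ := x
      · exact absurd rfl hv
      · exact ⟨_, adj_center.2 ⟨c, rfl⟩, depth_outV_of_eq rfl (Nat.zero_le _)⟩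
    · by_cases hc : x.1.head? = some c
      · exact ⟨_, (adj_arm h1).2 (.inl rfl), depth_outV_of_eq hc hj⟩
      · refine ⟨_, (adj_arm h1).2 (.inr rfl), ?_⟩
        rw [depth_posV, depth_posV, if_neg hc, if_neg hc]
        omega
  lower_unique v u u' hu hu' hd hd' := by
    rcases v.cases_center_or_arm with ⟨x, rfl⟩ | ⟨x, c, j, hj, h1, rfl⟩
    · have key (c : C) (h : depth (center C (fun w : Word C => k (endpoint σ o w)) x) =
          depth (outV move (fun w : Word C => k (endpoint σ o w)) x c 0) + 1) :
          x.1.head? = some c := by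
        by_contra hc
        have := depth_outV_of_ne (k := k) (o := o) hσ hc (Nat.zero_le _)
        rw [posV_zero] at this
        omega
      obtain ⟨c, rfl⟩ := adj_center.1 hu
      obtain ⟨d, rfl⟩ := adj_center.1 hu'
      obtain rfl : c = d := Option.some.inj ((key c hd).symm.trans (key d hd'))
      rfl
    · by_cases hc : x.1.head? = some c
      · have key : depth (posV (fun w : Word C => k (endpoint σ o w)) x c j hj) ≠
            depth (posV (fun w : Word C => k (endpoint σ o w)) x c (j - 1) (by omega)) + 1 := by
          have hlen := lt_len_of_head? (σ := σ) (k := k) (o := o) hc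
          rw [depth_posV, depth_posV, if_pos hc, if_pos hc]
          omega
        rcases (adj_arm h1).1 hu with rfl | rfl
        · rcases (adj_arm h1).1 hu' with rfl | rfl
          · rfl
          · exact absurd hd' key
        · exact absurd hd key
      · have key : depth (posV (fun w : Word C => k (endpoint σ o w)) x c j hj) ≠
            depth (outV move (fun w : Word C => k (endpoint σ o w)) x c j) + 1 := by
          have := depth_outV_of_ne (k := k) (o := o) hσ hc hj
          omega
        rcases (adj_arm h1).1 hu with rfl | rfl
        · exact absurd hd key
        · rcases (adj_arm h1).1 hu' with rfl | rfl
          · exact absurd hd' key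
          · rfl

lemma len_le_depth {N : ℕ} (hN : ∀ q, k q ≤ N) (v : CoverVert σ k o) :
    len σ k o v.1.1.1 ≤ depth v + N := by
  rcases v.cases_center_or_arm with ⟨x, rfl⟩ | ⟨x, c, j, hj, h1, rfl⟩
  · exact Nat.le_add_right _ _
  · have h2 := hN (endpoint σ o x)
    rw [depth_posV]
    show len σ k o x.1 ≤ _
    split_ifs <;> omega

variable [Finite C] [Finite Q]

lemma exists_ball_bound (σ : C → Q → Q) (k : Q → ℕ) (o : Q) : ∃ N D : ℕ, ∀ n,
    {v : CoverVert σ k o | depth v ≤ n}.Finite ∧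
      {v : CoverVert σ k o | depth v ≤ n}.ncard ≤ D * (short σ k (n + N)).ncard := by
  obtain ⟨N, hN⟩ := (Set.finite_range k).bddAbove
  have hN (q : Q) : k q ≤ N := hN ⟨q, rfl⟩
  let S : Set (Option (C × ℕ)) := insert none (some '' ((Set.univ : Set C) ×ˢ Set.Iic N))
  have hS : S.Finite := ((Set.finite_univ.prod (Set.finite_Iic N)).image some).insert none
  refine ⟨N, S.ncard, fun n => ?_⟩
  let F : CoverVert σ k o → Option (C × ℕ) × List C := fun v => (v.1.2, v.1.1.1)
  have hF : Function.Injective F := fun u v h =>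
    Subtype.ext (Prod.ext (Subtype.ext (congrArg Prod.snd h)) (congrArg Prod.fst h))
  have hmaps : Set.MapsTo F {v | depth v ≤ n} (S ×ˢ short σ k (n + N)) := by
    intro v hv
    refine ⟨?_, v.1.1.2, o, (len_le_depth hN v).trans (Nat.add_le_add_right hv N)⟩
    obtain ⟨⟨x, _ | ⟨c, j⟩⟩, hx⟩ := v
    · exact .inl rfl
    · exact .inr ⟨(c, j), ⟨trivial, (hx (c, j) rfl).2.trans (hN _)⟩, rfl⟩
  have hfin := hS.prod (short_finite (σ := σ) (k := k) (n + N))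
  refine ⟨Set.Finite.of_injOn hmaps hF.injOn hfin, ?_⟩
  rw [← Set.ncard_prod]
  exact Set.ncard_le_ncard_of_injOn F hmaps hF.injOn hfin

lemma exists_short_bound (hC : ∀ a b : C, ∃ c, c ≠ a ∧ c ≠ b) (hσ : ∀ c q, σ c (σ c q) = q)
    (ho : ∀ q, ∃ w, Reduced w ∧ act σ w o = q) (k : Q → ℕ) : ∃ M D : ℕ, ∀ n,
      (short σ k n).ncard ≤ D * {v : CoverVert σ k o | depth v ≤ n + M}.ncard := by
  have hp : ∀ x : Q × Option C, ∃ p, Reduced p ∧ act σ p o = x.1 ∧ ∀ c ∈ x.2, p.head? ≠ some c := by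
    rintro ⟨q, _ | c⟩
    · obtain ⟨p, h1, h2⟩ := ho q
      exact ⟨p, h1, h2, by simp⟩
    · obtain ⟨p, h1, h2, h3⟩ := exists_reach_avoiding hC hσ ho q c
      exact ⟨p, h1, h2, by simpa using h3⟩
  choose p hp1 hp2 hp3 using hp
  obtain ⟨M, hM⟩ := (Set.finite_range fun x => len σ k o (p x)).bddAbove
  have hM (x) : len σ k o (p x) ≤ M := hM ⟨x, rfl⟩
  refine ⟨M, Nat.card (Q × Option C), fun n => ?_⟩
  obtain ⟨_, _, hfin⟩ := exists_ball_bound σ k o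
  have hB := (hfin (n + M)).1
  let proj : CoverVert σ k o → List C := fun v => v.1.1.1
  have hq : ∀ w : List C, ∃ q, w ∈ short σ k n → len σ k q w ≤ n := by
    intro w
    by_cases hw : w ∈ short σ k n
    · obtain ⟨-, q, hq⟩ := hw
      exact ⟨q, fun _ => hq⟩
    · exact ⟨o, fun h => absurd h hw⟩
  choose q hq using hq
  let F : List C → (Q × Option C) × List C :=
    fun w => ((q w, w.getLast?), w ++ p (q w, w.getLast?))
  have hF : Function.Injective F := by
    intro u v h
    simp only [F, Prod.mk.injEq] at h
    obtain ⟨⟨h1, h2⟩, h3⟩ := h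
    rw [h1, h2] at h3
    exact List.append_cancel_right h3
  have hmaps : Set.MapsTo F (short σ k n)
      (Set.univ ×ˢ (proj '' {v : CoverVert σ k o | depth v ≤ n + M})) := by
    intro w hw
    have hred : Reduced (w ++ p (q w, w.getLast?)) := by
      refine List.isChain_append.2 ⟨hw.1, hp1 _, ?_⟩
      rintro a ha b hb rfl
      exact hp3 (q w, w.getLast?) a ha hb
    refine ⟨trivial, center C _ ⟨_, hred⟩, ?_, rfl⟩
    show len σ k o (w ++ p (q w, w.getLast?)) ≤ n + M
    rw [len_append, hp2]
    exact Nat.add_le_add (hq w hw) (hM _)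
  calc (short σ k n).ncard
      ≤ (Set.univ ×ˢ (proj '' {v : CoverVert σ k o | depth v ≤ n + M})).ncard :=
        Set.ncard_le_ncard_of_injOn F hmaps hF.injOn (Set.finite_univ.prod (hB.image proj))
    _ = Nat.card (Q × Option C) * (proj '' {v : CoverVert σ k o | depth v ≤ n + M}).ncard := by
        rw [Set.ncard_prod, Set.ncard_univ]
    _ ≤ _ := Nat.mul_le_mul_left _ (Set.ncard_image_le hB)

lemma HasGrowth.tendsto_ball (hC : ∀ a b : C, ∃ c, c ≠ a ∧ c ≠ b)
    (hσ : ∀ c q, σ c (σ c q) = q) (ho : ∀ q, ∃ w, Reduced w ∧ act σ w o = q) {Λ : ℝ}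
    (h : HasGrowth σ k Λ) :
    Tendsto (fun n : ℕ => ({v : CoverVert σ k o | depth v ≤ n}.ncard : ℝ) ^ (1 / (n : ℝ)))
      atTop (𝓝 (Real.exp Λ)) := by
  have : Nonempty Q := ⟨o⟩
  obtain ⟨N, D, hN⟩ := exists_ball_bound σ k o
  obtain ⟨M, E, hM⟩ := exists_short_bound hC hσ ho k
  set b : ℕ → ℕ := fun n => {v : CoverVert σ k o | depth v ≤ n}.ncard with hb
  have hbpos (n : ℕ) : 0 < b n :=
    (Set.ncard_pos (hN n).1).2 ⟨center C _ ⟨[], reduced_nil⟩, Nat.zero_le n⟩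
  have hbmono : Monotone b := fun m n hmn =>
    Set.ncard_le_ncard (fun v hv => le_trans hv hmn) (hN n).1
  have hsmono : Monotone fun n => (short σ k n).ncard := fun m n hmn =>
    Set.ncard_le_ncard (fun w ⟨h1, q, hq⟩ => ⟨h1, q, hq.trans hmn⟩) (short_finite n)
  have key {x y : ℕ} (hx : 0 < x) (hy : 0 < y) (hxy : x ≤ (D + E) * y) :
      Real.log x ≤ Real.log y + Real.log (D + E : ℕ) := by
    have hDE : D + E ≠ 0 := by rintro e; simp [e] at hxy; omega
    rw [add_comm, ← Real.log_mul (by exact_mod_cast hDE) (by exact_mod_cast hy.ne')]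
    exact Real.log_le_log (by exact_mod_cast hx) (by exact_mod_cast hxy)
  have hlim : Tendsto (fun n : ℕ => Real.log (b n) / n) atTop (𝓝 Λ) := by
    refine tendsto_of_sandwich (f := fun n => Real.log (short σ k n).ncard)
      (g := fun n => Real.log (b n)) (K := N + M) (D := Real.log (D + E : ℕ)) h
      (fun n => ?_) (fun n => ?_)
    · exact key (short_ncard_pos n) (hbpos _) ((hM n).trans
        (Nat.mul_le_mul (Nat.le_add_left _ _) (hbmono (by omega))))
    · exact key (hbpos n) (short_ncard_pos _) ((hN n).2.trans
        (Nat.mul_le_mul (Nat.le_add_right _ _) (hsmono (by omega))))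
  refine ((Real.continuous_exp.tendsto Λ).comp hlim).congr fun n => ?_
  rw [Real.rpow_def_of_pos (by exact_mod_cast hbpos n), mul_one_div]
  rfl

end UniversalCover

lemma exists_growth_between {m : ℕ} (hm : 1 ≤ m) {β δ : ℝ} (hβ : 0 ≤ β) (hβm : β ≤ Real.log m)
    (hδ : 0 < δ) : ∃ (Q : Type) (σ : Fin (m + 1) → Q → Q) (o : Q) (k : Q → ℕ) (Λ : ℝ) (R : ℕ),
      Finite Q ∧ (∀ c q, σ c (σ c q) = q) ∧ 2 ≤ R ∧ GirthGT σ R ∧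
      (∀ q, ∃ w, Reduced w ∧ act σ w o = q) ∧ HasGrowth σ k Λ ∧ β ≤ Λ ∧ Λ ≤ β + δ := by
  set A : ℝ := Real.log (Fintype.card (Fin (m + 1)) + 1) with hA
  have hA0 : 0 ≤ A := Real.log_nonneg (le_add_of_nonneg_left (Nat.cast_nonneg _))
  obtain ⟨R, hR⟩ := exists_nat_ge (2 * A / δ)
  obtain ⟨Q, σ, o, hQ, hσ, hg, ho⟩ := exists_finite_action (Fin (m + 1)) (R + 2)
  have : Nonempty Q := ⟨o⟩
  have hRA : 2 * A ≤ R * δ := (div_le_iff₀ hδ).1 hR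
  suffices ∃ k Λ, HasGrowth σ k Λ ∧ β ≤ Λ ∧ Λ ≤ β + δ by
    obtain ⟨k, Λ, h1, h2, h3⟩ := this
    exact ⟨Q, σ, o, k, Λ, R + 2, hQ, hσ, by omega, hg, ho, h1, h2, h3⟩
  by_cases hK : ∃ Λ, HasGrowth σ (fun _ => R) Λ ∧ β ≤ Λ
  · obtain ⟨Λ, h1, h2⟩ := hK
    refine ⟨_, Λ, h1, h2, ?_⟩
    have h3 := h1.const_le
    rw [← hA] at h3
    have hR0 : (0 : ℝ) ≤ R := Nat.cast_nonneg R
    by_contra! h4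
    nlinarith
  · push Not at hK
    obtain ⟨Λ₀, h₀⟩ := exists_growth σ (fun _ => 0)
    obtain ⟨k, Λ, h1, h2, h3⟩ := exists_growth_near hg h₀ (hβm.trans (HasGrowth.zero_ge hm h₀)) hK
    refine ⟨k, Λ, h1, h2, h3.trans ?_⟩
    rw [← hA]
    gcongr
    rw [div_le_iff₀ (by positivity)]
    push_cast
    nlinarith

lemma exists_ne_ne {m : ℕ} (hm : 2 ≤ m) (a b : Fin (m + 1)) : ∃ c, c ≠ a ∧ c ≠ b := by
  have : ({a, b} : Finset (Fin (m + 1))).card < Fintype.card (Fin (m + 1)) :=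
    Finset.card_le_two.trans_lt (by simp; omega)
  obtain ⟨c, hc⟩ := Finset.exists_mem_notMem_of_card_lt_card
    (this.trans_eq Finset.card_univ.symm)
  exact ⟨c, by simpa using hc.2⟩

end StarTree

open StarTree

/-- The growth rates of strongly periodic trees (universal covers of finite
graphs, i.e. trees covering a finite connected graph) with degrees in
`{2, …, 2r}` are dense in `[1, 2r-1]`. -/
theorem stmt_2 (r : ℕ) (hr : 2 ≤ r) (α : ℝ) (hα1 : 1 ≤ α) (hα2 : α ≤ 2 * (r : ℝ) - 1)
    (ε : ℝ) (hε : 0 < ε) :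
    ∃ (V : Type) (T : SimpleGraph V) (W : Type) (G : SimpleGraph W) (f : V → W)
      (o : V) (L : ℝ),
      Infinite V ∧ T.IsTree ∧
      (∀ v : V, 2 ≤ (T.neighborSet v).ncard ∧ (T.neighborSet v).ncard ≤ 2 * r) ∧
      Finite W ∧ G.Connected ∧
      IsGraphCovering T G f ∧ Function.Surjective f ∧
      Tendsto (fun n : ℕ => (({v : V | T.dist o v ≤ n}).ncard : ℝ) ^ (1 / (n : ℝ)))
        atTop (𝓝 L) ∧
      |L - α| < ε := by
  have hα0 : 0 < α := by linarith
  obtain ⟨m, hm⟩ : ∃ m, m + 1 = 2 * r := ⟨2 * r - 1, by omega⟩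
  have hmr : (m : ℝ) + 1 = 2 * r := by exact_mod_cast hm
  obtain ⟨δ, hδ, hexp⟩ := Metric.continuousAt_iff.1
    (Real.continuous_exp.continuousAt (x := Real.log α)) ε hε
  obtain ⟨Q, σ, o, k, Λ, R, hQ, hσ, hR2, hR, ho, hΛ, h1, h2⟩ :=
    exists_growth_between (m := m) (by omega) (Real.log_nonneg hα1)
      (Real.log_le_log hα0 (by linarith)) (half_pos hδ)
  have hφ := endpoint_move (o := o) hσ
  have hne : ∀ (c : Fin (m + 1)) (x : Word (Fin (m + 1))), move c x ≠ x := fun c x h =>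
    hR.ne (by omega) c (endpoint σ o x) (by rw [← hφ, h])
  have hinjσ := hR.injective hR2 hσ
  have hinj : ∀ (x : Word (Fin (m + 1))) c d, move c x = move d x → c = d := fun x c d h =>
    hinjσ (endpoint σ o x) c d (by rw [← hφ, ← hφ, h])
  have hdepth := isDepth_depth (k := k) (o := o) hσ hne
  have hcov := isGraphCovering_starMap (k := k) (hτ := move_move) (hne := hne) hφ hσ
    (hR.ne (by omega)) hinjσ
  have hsurj : Function.Surjective (starMap (C := Fin (m + 1)) (endpoint σ o) k) :=
    starMap_surjective fun q => (ho q).elim fun w hw => ⟨⟨w, hw.1⟩, hw.2⟩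
  refine ⟨_, _, _, _, _, center _ _ ⟨[], reduced_nil⟩, Real.exp Λ, ?_, hdepth.isTree,
    fun v => ?_, inferInstance, ?_, hcov, hsurj, ?_, ?_⟩
  · have : Nonempty (Fin m) := ⟨⟨0, by omega⟩⟩
    refine Infinite.of_injective (fun w : List (Fin m) => center _ _ ⟨encode w, encode_reduced w⟩)
      fun u v h => encode_injective ?_
    exact congrArg (fun v : CoverVert σ k o => v.1.1.1) h
  · have := two_le_ncard_neighborSet (hτ := move_move) (hne := hne) hinj
      (by rw [Fintype.card_fin]; omega) v
    rw [Fintype.card_fin] at this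
    exact ⟨this.1, this.2.trans_eq hm⟩
  · exact hdepth.connected.map ⟨_, fun {u v} h => hcov.1 u v h⟩ hsurj
  · simp only [hdepth.dist_eq]
    exact hΛ.tendsto_ball (exists_ne_ne (by omega)) hσ ho
  · have := hexp (x := Λ) (by rw [Real.dist_eq, abs_lt]; constructor <;> linarith)
    rwa [Real.dist_eq, Real.exp_log hα0] at this
end
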